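/- arXiv:1501.06865 — 2 statements merged into one kernel-verified Lean document; each statement's English description precedes it below -/
import Mathlib

section
/- Let d = 1, W ∈ S_{2,2}(ℝ), and let η = η₀ + η̃ be admissible with mean value η₀ ∈ ℝ. Suppose there exist L(1), L(-1) ∈ ℝ such that lim_{r→+∞} r²W(rω) = L(ω) for ω ∈ {+1,-1}. Then lim_{E↑0} (|ln|E||)^{-1} N(E; ηW) = (1/(2π)) [ (η₀L(1) + 1/4)_-^{1/2} + (η₀L(-1) + 1/4)_-^{1/2} ]. If, moreover, min{η₀L(1), η₀L(-1)} > -1/4, then sup_{E<0} N(E; ηW) < ∞. -/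
open MeasureTheory Filter Real Set Topology

noncomputable section

/-- Glazman variational count of eigenvalues of `-d²/dx² + V` below `E`, `d = 1`. -/
noncomputable def schN1 (V : ℝ → ℝ) (E : ℝ) : ℕ∞ :=
  ⨆ F : {F : Submodule ℝ (ℝ → ℝ) //
      (∀ u ∈ F, ContDiff ℝ (⊤ : ℕ∞) u ∧ HasCompactSupport u) ∧
      (∀ u ∈ F, u ≠ 0 →
        (∫ x, (deriv u x ^ 2 + V x * u x ^ 2)) < E * ∫ x, u x ^ 2)},
    (Module.finrank ℝ F.1 : ℕ∞)

/-- The symbol class `S_{m,ρ}(ℝ)`. -/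
def SClass1 (m : ℕ) (ρ : ℝ) (W : ℝ → ℝ) : Prop :=
  ContDiff ℝ m W ∧ ∃ C : ℝ, 0 < C ∧ ∀ k : ℕ, k ≤ m → ∀ x : ℝ,
    |iteratedDeriv k W x| ≤ C * (1 + |x|) ^ (-ρ - (k : ℝ))

/-- Admissibility of `η` with mean value `η₀`, witnessed by the solution `φ` of `φ'' = η - η₀`. -/
structure IsAdmissible1 (η : ℝ → ℝ) (η₀ : ℝ) (φ : ℝ → ℝ) : Prop where
  background_ne : ∃ x, η x ≠ η₀
  smooth : ContDiff ℝ 2 φ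
  bounded : ∃ M : ℝ, ∀ x, |φ x| ≤ M ∧ |deriv φ x| ≤ M ∧ |deriv (deriv φ) x| ≤ M
  poisson : ∀ x, deriv (deriv φ) x = η x - η₀
  normalized :
    Filter.limsup (fun R : ℝ => (∫ x in Set.Ioo (-(R/2)) (R/2), φ x) / R) Filter.atTop = 0


/-- Upper bound on the count by vanishing on a finite set of points. -/
lemma count_le_card (V : ℝ → ℝ) (E : ℝ) (S : Finset ℝ)
    (h : ∀ u : ℝ → ℝ, ContDiff ℝ (⊤ : ℕ∞) u → HasCompactSupport u → (∀ x ∈ S, u x = 0) →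
      E * ∫ x, u x ^ 2 ≤ ∫ x, (deriv u x ^ 2 + V x * u x ^ 2)) :
    schN1 V E ≤ (S.card : ℕ∞) := by
  unfold schN1
  refine iSup_le ?_
  rintro ⟨F, h1, h2⟩
  by_contra hlt
  push Not at hlt
  have hlt' : S.card < Module.finrank ℝ F := by exact_mod_cast hlt
  have : FiniteDimensional ℝ F := FiniteDimensional.of_finrank_pos (by omega)
  let f : F →ₗ[ℝ] (S → ℝ) :=
    { toFun := fun u x => u.1 x.1
      map_add' := fun u v => by ext; simp
      map_smul' := fun c u => by ext; simp }
  have hinj : Function.Injective f := by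
    rw [← LinearMap.ker_eq_bot, LinearMap.ker_eq_bot']
    intro u hu
    by_contra hne
    have hne' : u.1 ≠ 0 := fun h0 => hne (Subtype.ext h0)
    have := h2 u.1 u.2 hne'
    have h3 := h u.1 (h1 u.1 u.2).1 (h1 u.1 u.2).2 (fun x hx => congrFun hu ⟨x, hx⟩)
    linarith
  have := LinearMap.finrank_le_finrank_of_injective hinj
  simp at this
  omega

lemma integrable_form {V u : ℝ → ℝ} (hV : Continuous V) (hu : ContDiff ℝ (⊤ : ℕ∞) u)
    (hc : HasCompactSupport u) :
    Integrable (fun x => deriv u x ^ 2 + V x * u x ^ 2) := by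
  have hd : Continuous (deriv u) := hu.continuous_deriv (by simp)
  apply Continuous.integrable_of_hasCompactSupport
  · have := hu.continuous
    fun_prop
  · apply HasCompactSupport.add
    · have : HasCompactSupport (deriv u) := hc.deriv
      exact this.comp_left (g := fun t : ℝ => t ^ 2) (by simp)
    · have : HasCompactSupport (fun x => u x ^ 2) := hc.comp_left (g := fun t : ℝ => t ^ 2) (by simp)
      exact this.mul_left

lemma integrable_sq {u : ℝ → ℝ} (hu : ContDiff ℝ (⊤ : ℕ∞) u)
    (hc : HasCompactSupport u) : Integrable (fun x => u x ^ 2) := by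
  apply Continuous.integrable_of_hasCompactSupport
  · have := hu.continuous
    fun_prop
  · exact hc.comp_left (g := fun t : ℝ => t ^ 2) (by simp)

lemma form_shift {V u : ℝ → ℝ} (E : ℝ) (hV : Continuous V) (hu : ContDiff ℝ (⊤ : ℕ∞) u)
    (hc : HasCompactSupport u) :
    (∫ x, (deriv u x ^ 2 + (V x - E) * u x ^ 2)) =
      (∫ x, (deriv u x ^ 2 + V x * u x ^ 2)) - E * ∫ x, u x ^ 2 := by
  rw [← integral_const_mul, ← integral_sub (integrable_form hV hu hc)
    ((integrable_sq hu hc).const_mul E)]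
  congr 1
  ext x
  ring

/-- Lower bound on the count by a family of test functions with disjoint supports. -/
lemma card_le_count (V : ℝ → ℝ) (hV : Continuous V) (E : ℝ) {ι : Type} [Fintype ι]
    (u : ι → ℝ → ℝ) (hu : ∀ i, ContDiff ℝ (⊤ : ℕ∞) (u i)) (hc : ∀ i, HasCompactSupport (u i))
    (hd : ∀ i j, i ≠ j → ∀ x, (u i x = 0 ∧ deriv (u i) x = 0) ∨ (u j x = 0 ∧ deriv (u j) x = 0))
    (hq : ∀ i, ∫ x, (deriv (u i) x ^ 2 + (V x - E) * u i x ^ 2) < 0) :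
    (Fintype.card ι : ℕ∞) ≤ schN1 V E := by
  classical
  have hne : ∀ i, ∃ x, u i x ≠ 0 := by
    intro i
    by_contra hcon
    push Not at hcon
    have h0 : u i = 0 := funext hcon
    have := hq i
    rw [h0] at this
    simp at this
  have hli : LinearIndependent ℝ u := by
    rw [Fintype.linearIndependent_iff]
    intro g hg i
    obtain ⟨x, hx⟩ := hne i
    have h1 := congrFun hg x
    simp only [Finset.sum_apply, Pi.smul_apply, smul_eq_mul, Pi.zero_apply] at h1
    rw [Finset.sum_eq_single i] at h1
    · exact (mul_eq_zero.mp h1).resolve_right hx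
    · intro j _ hj
      rcases hd i j hj.symm x with h | h
      · exact absurd h.1 hx
      · rw [h.1, mul_zero]
    · simp
  have key : ∀ (c : ι → ℝ) (f : ι → ℝ), (∀ i j, i ≠ j → f i = 0 ∨ f j = 0) →
      (∑ i, c i * f i) ^ 2 = ∑ i, c i ^ 2 * f i ^ 2 := by
    intro c f hf
    rw [sq, Finset.sum_mul_sum]
    refine Finset.sum_congr rfl fun i _ => ?_
    rw [Finset.sum_eq_single i]
    · ring
    · intro j _ hj
      rcases hf i j hj.symm with h | h <;> rw [h] <;> ring
    · simp
  let F : Submodule ℝ (ℝ → ℝ) := Submodule.span ℝ (Set.range u)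
  have hF : (∀ v ∈ F, ContDiff ℝ (⊤ : ℕ∞) v ∧ HasCompactSupport v) ∧
      (∀ v ∈ F, v ≠ 0 →
        (∫ x, (deriv v x ^ 2 + V x * v x ^ 2)) < E * ∫ x, v x ^ 2) := by
    have h1 : ∀ v ∈ F, ContDiff ℝ (⊤ : ℕ∞) v ∧ HasCompactSupport v := by
      intro v hv
      induction hv using Submodule.span_induction with
      | mem x hx => obtain ⟨i, rfl⟩ := hx; exact ⟨hu i, hc i⟩
      | zero => exact ⟨contDiff_const, HasCompactSupport.zero⟩
      | add x y _ _ hx hy => exact ⟨hx.1.add hy.1, hx.2.add hy.2⟩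
      | smul a x _ hx => exact ⟨contDiff_const.smul hx.1, hx.2.smul_left (f := fun _ => a)⟩
    refine ⟨h1, ?_⟩
    intro v hv hv0
    have h2 := h1 v hv
    obtain ⟨c, hcv⟩ := (Submodule.mem_span_range_iff_exists_fun ℝ).1 hv
    have hvx : ∀ x, v x = ∑ i, c i * u i x := by
      intro x
      rw [← hcv]
      simp
    have hdx : ∀ x, deriv v x = ∑ i, c i * deriv (u i) x := by
      intro x
      have : v = fun x => ∑ i, c i * u i x := funext hvx
      rw [this]
      have hdd : ∀ i, HasDerivAt (u i) (deriv (u i) x) x := fun i =>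
        ((hu i).differentiable (by simp)).differentiableAt.hasDerivAt
      exact (HasDerivAt.fun_sum fun i _ => (hdd i).const_mul (c i)).deriv
    have hform : (∫ x, (deriv v x ^ 2 + (V x - E) * v x ^ 2)) =
        ∑ i, c i ^ 2 * ∫ x, (deriv (u i) x ^ 2 + (V x - E) * u i x ^ 2) := by
      simp_rw [← integral_const_mul]
      rw [← integral_finsetSum]
      · congr 1
        ext x
        rw [hvx, hdx, key c (fun i => u i x), key c (fun i => deriv (u i) x), Finset.mul_sum,
          ← Finset.sum_add_distrib]
        · exact Finset.sum_congr rfl fun i _ => by ring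
        · intro i j hij
          exact (hd i j hij x).imp (fun h => h.2) (fun h => h.2)
        · intro i j hij
          exact (hd i j hij x).imp (fun h => h.1) (fun h => h.1)
      · intro i _
        exact (integrable_form (V := fun x => V x - E) (by fun_prop) (hu i) (hc i)).const_mul _
    have hlt : (∫ x, (deriv v x ^ 2 + (V x - E) * v x ^ 2)) < 0 := by
      rw [hform]
      have hcne : ∃ i, c i ≠ 0 := by
        by_contra hcon
        push Not at hcon
        apply hv0
        ext x
        rw [hvx]
        simp [hcon]
      obtain ⟨i, hi⟩ := hcne
      apply Finset.sum_neg'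
      · intro j _
        exact mul_nonpos_of_nonneg_of_nonpos (sq_nonneg _) (hq j).le
      · exact ⟨i, Finset.mem_univ _, mul_neg_of_pos_of_neg (by positivity) (hq i)⟩
    rw [form_shift E hV h2.1 h2.2] at hlt
    linarith
  have hcard : Module.finrank ℝ F = Fintype.card ι := finrank_span_eq_card hli
  unfold schN1
  rw [← hcard]
  exact le_iSup (fun F : {F : Submodule ℝ (ℝ → ℝ) //
      (∀ u ∈ F, ContDiff ℝ (⊤ : ℕ∞) u ∧ HasCompactSupport u) ∧
      (∀ u ∈ F, u ≠ 0 →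
        (∫ x, (deriv u x ^ 2 + V x * u x ^ 2)) < E * ∫ x, u x ^ 2)} =>
    (Module.finrank ℝ F.1 : ℕ∞)) ⟨F, hF⟩

/-- Riccati (ground state) inequality. -/
lemma riccati {U u h h' : ℝ → ℝ} {α β : ℝ} (hαβ : α ≤ β) (hU : Continuous U)
    (hu : ContDiff ℝ (⊤ : ℕ∞) u) (h0 : u α = 0) (h1 : u β = 0)
    (hh : ∀ x ∈ Icc α β, HasDerivAt h (h' x) x)
    (hr : ∀ x ∈ Icc α β, h' x + h x ^ 2 ≤ U x) :
    0 ≤ ∫ x in α..β, (deriv u x ^ 2 + U x * u x ^ 2) := by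
  have hdc : Continuous (deriv u) := hu.continuous_deriv (by simp)
  have huc := hu.continuous
  have hd : ∀ x ∈ Icc α β, HasDerivAt (fun y => h y * u y ^ 2)
      (h' x * u x ^ 2 + h x * (2 * u x * deriv u x)) x := by
    intro x hx
    have hux : HasDerivAt u (deriv u x) x :=
      (hu.differentiable (by simp)).differentiableAt.hasDerivAt
    have := (hh x hx).mul (hux.pow 2)
    refine this.congr_deriv ?_
    simp
  have := intervalIntegral.sub_le_integral_of_hasDeriv_right_of_le
    (g := fun y => h y * u y ^ 2) (g' := fun x => h' x * u x ^ 2 + h x * (2 * u x * deriv u x))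
    (φ := fun x => deriv u x ^ 2 + U x * u x ^ 2) hαβ
    (fun x hx => (hd x hx).continuousAt.continuousWithinAt)
    (fun x hx => (hd x (Ioo_subset_Icc_self hx)).hasDerivWithinAt)
    (Continuous.integrableOn_Icc (by fun_prop))
    (fun x hx => by
      have := hr x (Ioo_subset_Icc_self hx)
      nlinarith [mul_le_mul_of_nonneg_right this (sq_nonneg (u x)), sq_nonneg (deriv u x - h x * u x)])
  simpa [h0, h1] using this

lemma chain_intervals {U u : ℝ → ℝ} (hU : Continuous U) (hu : ContDiff ℝ (⊤ : ℕ∞) u)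
    (p : ℕ → ℝ) (n : ℕ)
    (h : ∀ k < n, 0 ≤ ∫ x in p k..p (k + 1), (deriv u x ^ 2 + U x * u x ^ 2)) :
    0 ≤ ∫ x in p 0..p n, (deriv u x ^ 2 + U x * u x ^ 2) := by
  have hdc : Continuous (deriv u) := hu.continuous_deriv (by simp)
  have huc := hu.continuous
  rw [← intervalIntegral.sum_integral_adjacent_intervals]
  · exact Finset.sum_nonneg fun k hk => h k (Finset.mem_range.1 hk)
  · intro k _
    exact Continuous.intervalIntegrable (by fun_prop) _ _

/-- Compact region. -/
lemma mid_region {V : ℝ → ℝ} (hV : Continuous V) (r s : ℝ) (hrs : r < s) :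
    ∃ S : Finset ℝ, ∀ U : ℝ → ℝ, Continuous U → (∀ x, V x ≤ U x) →
      ∀ u : ℝ → ℝ, ContDiff ℝ (⊤ : ℕ∞) u → (∀ x ∈ S, u x = 0) →
        0 ≤ ∫ x in r..s, (deriv u x ^ 2 + U x * u x ^ 2) := by
  obtain ⟨b, hb⟩ := (isCompact_Icc (a := r) (b := s)).bddBelow_image hV.continuousOn
  set κ : ℝ := 1 + |b| with hκ
  have hκ1 : 1 ≤ κ := by have := abs_nonneg b; linarith
  have hVb : ∀ x ∈ Icc r s, -κ ^ 2 ≤ V x := by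
    intro x hx
    have h1 : b ≤ V x := hb ⟨x, hx, rfl⟩
    have h2 := neg_abs_le b
    nlinarith
  obtain ⟨n, hn⟩ := exists_nat_gt (κ * (s - r))
  have hn0 : (0 : ℝ) < n := lt_of_le_of_lt (by nlinarith) hn
  set p : ℕ → ℝ := fun k => r + k * ((s - r) / n) with hp
  have hl : 0 < (s - r) / n := div_pos (by linarith) hn0
  have hl2 : κ * ((s - r) / n) ≤ 1 := by
    rw [← mul_div_assoc, div_le_one hn0]; exact hn.le
  refine ⟨(Finset.range (n + 1)).image p, ?_⟩
  intro U hU hVU u hu hz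
  have hzk : ∀ k ≤ n, u (p k) = 0 := fun k hk =>
    hz _ (Finset.mem_image_of_mem _ (Finset.mem_range.2 (by omega)))
  have hp0 : p 0 = r := by simp [hp]
  have hpn : p n = s := by simp only [hp]; field_simp; ring
  have := chain_intervals hU hu p n ?_
  · rwa [hp0, hpn] at this
  intro k hk
  have hstep : p (k + 1) = p k + (s - r) / n := by simp only [hp]; push_cast; ring
  set m := p k + (s - r) / n / 2 with hm
  have hpk : r ≤ p k := by simp only [hp]; have : (0:ℝ) ≤ k := k.cast_nonneg; nlinarith
  have hpk1 : p (k + 1) ≤ s := by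
    rw [← hpn]; simp only [hp]
    have : ((k + 1 : ℕ) : ℝ) ≤ n := by exact_mod_cast hk
    nlinarith
  have hcos : ∀ x ∈ Icc (p k) (p (k + 1)), cos (κ * (x - m)) ≠ 0 := by
    intro x hx
    have h1 : |x - m| ≤ (s - r) / n / 2 := by
      rw [abs_le]; constructor <;> [linarith [hx.1]; linarith [hx.2]]
    have h2 : |κ * (x - m)| ≤ 1 / 2 := by
      rw [abs_mul, abs_of_pos (by linarith : 0 < κ)]
      nlinarith
    rw [abs_le] at h2
    have := pi_gt_three
    exact (cos_pos_of_mem_Ioo ⟨by linarith, by linarith⟩).ne'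
  refine riccati (h := fun x => -κ * tan (κ * (x - m)))
    (h' := fun x => -κ * ((1 + tan (κ * (x - m)) ^ 2) * κ)) (by linarith) hU hu
    (hzk k (by omega)) (hzk _ (by omega)) ?_ ?_
  · intro x hx
    have hc := hcos x hx
    have h1 : HasDerivAt (fun x => κ * (x - m)) κ x := by
      simpa using ((hasDerivAt_id x).sub_const m).const_mul κ
    have h2 := ((hasDerivAt_tan hc).comp x h1).const_mul (-κ)
    refine h2.congr_deriv ?_
    rw [tan_eq_sin_div_cos]
    field_simp
    nlinarith [sin_sq_add_cos_sq (κ * (x - m))]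
  · intro x hx
    have := hVb x ⟨by linarith [hx.1], by linarith [hx.2]⟩
    have := hVU x
    nlinarith

structure HalfData (V A A' : ℝ → ℝ) (a C : ℝ) : Prop where
  contV : Continuous V
  diffA : ∀ x, HasDerivAt A (A' x) x
  contA' : Continuous A'
  Cpos : 0 < C
  bA : ∀ x, 1 ≤ x → |A x| ≤ C / x ^ 2
  bV : ∀ x, 1 ≤ x → |V x| ≤ C / x ^ 2
  lim : Tendsto (fun x => x ^ 2 * (V x - A' x)) atTop (𝓝 a)

set_option maxHeartbeats 1000000 in
lemma interval_lemma {V A A' : ℝ → ℝ} {a C : ℝ} (D : HalfData V A A' a C) {ν θ : ℝ}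
    (hν0 : 0 ≤ ν) (hθ0 : 0 ≤ θ) (hθ : θ < π / 2) (hν : -(a + 1 / 4) < ν ^ 2) :
    ∃ R : ℝ, 1 ≤ R ∧ ∀ α β, R ≤ α → α ≤ β → ν * (log β - log α) ≤ 2 * θ →
      ∀ U : ℝ → ℝ, Continuous U → (∀ x, V x ≤ U x) →
      ∀ u : ℝ → ℝ, ContDiff ℝ (⊤ : ℕ∞) u → u α = 0 → u β = 0 →
        0 ≤ ∫ x in α..β, (deriv u x ^ 2 + U x * u x ^ 2) := by
  have hC := D.Cpos
  set γ := (ν ^ 2 + 1 / 4 + a) / 3 with hγ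
  have hγ0 : 0 < γ := by rw [hγ]; linarith
  set τ := tan θ with hτ
  have hτ0 : 0 ≤ τ := tan_nonneg_of_nonneg_of_le_pi_div_two hθ0 hθ.le
  set K := 2 * (1 / 2 + ν * τ) * C + C ^ 2 with hK
  have hK0 : 0 < K := by positivity
  have e1 : ∀ᶠ x in atTop, a - γ < x ^ 2 * (V x - A' x) :=
    D.lim.eventually (lt_mem_nhds (by linarith))
  obtain ⟨R0, hR0⟩ := eventually_atTop.1 e1
  refine ⟨max (max R0 1) (K / γ), le_max_of_le_left (le_max_right _ _), ?_⟩
  intro α β hRα hαβ hT U hU hVU u hu hα hβ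
  have hα1 : 1 ≤ α := le_trans (le_max_of_le_left (le_max_right _ _)) hRα
  have hαR : R0 ≤ α := le_trans (le_max_of_le_left (le_max_left _ _)) hRα
  have hαK : K / γ ≤ α := le_trans (le_max_right _ _) hRα
  set m := (log α + log β) / 2 with hm
  have hang : ∀ x ∈ Icc α β, |ν * (log x - m)| ≤ θ := by
    intro x hx
    have hx0 : 0 < x := by linarith [hx.1]
    have l1 : log α ≤ log x := log_le_log (by linarith) hx.1
    have l2 : log x ≤ log β := log_le_log hx0 hx.2
    rw [abs_le]
    constructor
    · nlinarith
    · nlinarith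
  refine riccati (h := fun x => (1 / 2 - ν * tan (ν * (log x - m))) / x + A x)
    (h' := fun x => -(ν ^ 2 * (1 + tan (ν * (log x - m)) ^ 2) +
      (1 / 2 - ν * tan (ν * (log x - m)))) / x ^ 2 + A' x) hαβ hU hu hα hβ ?_ ?_
  · intro x hx
    have hx0 : 0 < x := by linarith [hx.1]
    have ha := abs_le.1 (hang x hx)
    have hc : cos (ν * (log x - m)) ≠ 0 :=
      (cos_pos_of_mem_Ioo ⟨by linarith, by linarith⟩).ne'
    have h1 : HasDerivAt (fun x => ν * (log x - m)) (ν * x⁻¹) x :=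
      ((hasDerivAt_log hx0.ne').sub_const m).const_mul ν
    have h2 := (((hasDerivAt_tan hc).comp x h1).const_mul ν).const_sub (1 / 2)
    have h3 := (h2.div (hasDerivAt_id x) hx0.ne').add (D.diffA x)
    refine h3.congr_deriv ?_
    simp only [Function.comp, id]
    have : 1 / cos (ν * (log x - m)) ^ 2 = 1 + tan (ν * (log x - m)) ^ 2 := by
      rw [tan_eq_sin_div_cos]
      field_simp
      nlinarith [sin_sq_add_cos_sq (ν * (log x - m))]
    rw [this]
    field_simp
    ring
  · intro x hx
    refine le_trans ?_ (hVU x)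
    have hx1 : 1 ≤ x := by linarith [hx.1]
    have hx0 : 0 < x := by linarith
    have ha := abs_le.1 (hang x hx)
    set t := tan (ν * (log x - m)) with ht
    have ht1 : t ≤ τ := strictMonoOn_tan.monotoneOn ⟨by linarith, by linarith⟩
      ⟨by linarith, hθ⟩ ha.2
    have ht2 : -τ ≤ t := by
      rw [hτ, ← tan_neg]
      exact strictMonoOn_tan.monotoneOn ⟨by linarith, by linarith⟩
        ⟨by linarith, by linarith⟩ ha.1
    have hlim := hR0 x (by linarith [hx.1])
    have hA := D.bA x hx1
    have hy : |x * A x| ≤ C / x := by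
      rw [abs_mul, abs_of_pos hx0]
      calc x * |A x| ≤ x * (C / x ^ 2) := by gcongr
        _ = C / x := by field_simp
    set y := x * A x with hyd
    have hAy : A x = y / x := by rw [hyd]; field_simp
    have hcoef : |1 / 2 - ν * t| ≤ 1 / 2 + ν * τ := by
      have n1 := mul_le_mul_of_nonneg_left ht1 hν0
      have n2 := mul_le_mul_of_nonneg_left ht2 hν0
      rw [abs_le]
      constructor <;> linarith
    have b1 : 2 * (1 / 2 - ν * t) * y ≤ 2 * ((1 / 2 + ν * τ) * (C / x)) := by
      have : (1 / 2 - ν * t) * y ≤ (1 / 2 + ν * τ) * (C / x) := by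
        calc _ ≤ |(1 / 2 - ν * t) * y| := le_abs_self _
          _ = |1 / 2 - ν * t| * |y| := abs_mul _ _
          _ ≤ _ := by gcongr
      linarith
    have b2 : y ^ 2 ≤ C ^ 2 / x := by
      have hcx : C / x ≤ C := div_le_self hC.le hx1
      calc y ^ 2 = |y| * |y| := by rw [← sq, sq_abs]
        _ ≤ C / x * C := by gcongr; exact hy.trans hcx
        _ = _ := by ring
    have b3 : K / x ≤ γ := by
      rw [div_le_iff₀ hx0]
      have : K / γ ≤ x := by linarith [hx.1]
      rw [div_le_iff₀ hγ0] at this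
      linarith
    have b4 : K / x = 2 * ((1 / 2 + ν * τ) * (C / x)) + C ^ 2 / x := by rw [hK]; ring
    have e : -(ν ^ 2 * (1 + t ^ 2) + (1 / 2 - ν * t)) / x ^ 2 + A' x +
        ((1 / 2 - ν * t) / x + A x) ^ 2 =
        A' x + (-(ν ^ 2 + 1 / 4) + 2 * (1 / 2 - ν * t) * y + y ^ 2) / x ^ 2 := by
      rw [hAy]; field_simp; ring
    rw [e]
    have : (-(ν ^ 2 + 1 / 4) + 2 * (1 / 2 - ν * t) * y + y ^ 2) / x ^ 2 ≤ V x - A' x := by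
      rw [div_le_iff₀ (by positivity)]
      linarith
    linarith

/-- Vanishing on `S` makes the form on `[R, ∞)` nonnegative. -/
def GoodSet (V : ℝ → ℝ) (R E : ℝ) (S : Finset ℝ) : Prop :=
  ∀ u : ℝ → ℝ, ContDiff ℝ (⊤ : ℕ∞) u → HasCompactSupport u → (∀ x ∈ S, u x = 0) →
    ∀ᶠ b in atTop, 0 ≤ ∫ x in R..b, (deriv u x ^ 2 + (V x - E) * u x ^ 2)

lemma eventually_zero {u : ℝ → ℝ} (hc : HasCompactSupport u) : ∀ᶠ b in atTop, u b = 0 := by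
  have h := hasCompactSupport_iff_eventuallyEq.1 hc
  exact h.filter_mono (by rw [coclosedCompact_eq_cocompact]; exact atTop_le_cocompact)

lemma good_hardy {V A A' : ℝ → ℝ} {a C : ℝ} (D : HalfData V A A' a C) (ha : -(1 / 4) < a) :
    ∃ R : ℝ, 1 ≤ R ∧ ∀ E < 0, GoodSet V R E {R} := by
  obtain ⟨R, hR1, hR⟩ := interval_lemma D (ν := 0) (θ := 0) le_rfl le_rfl (by positivity)
    (by linarith)
  refine ⟨R, hR1, ?_⟩
  intro E hE u hu hc hz
  have hV := D.contV
  filter_upwards [eventually_zero hc, eventually_ge_atTop R] with b hb hbR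
  exact hR R b le_rfl hbR (by simp) (fun x => V x - E) (by fun_prop) (fun x => by linarith) u hu
    (hz R (by simp)) hb

lemma good_log {V A A' : ℝ → ℝ} {a C : ℝ} (D : HalfData V A A' a C) {σ : ℝ}
    (hσ : 1 / (2 * π) * √(max (-(a + 1 / 4)) 0) < σ) :
    ∃ R B : ℝ, 1 ≤ R ∧ ∀ E : ℝ, -1 < E → E < 0 → ∃ S : Finset ℝ, GoodSet V R E S ∧
      (S.card : ℝ) ≤ σ * |log (|E|)| + B := by
  set ν0 := √(max (-(a + 1 / 4)) 0) with hν0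
  have hν00 : 0 ≤ ν0 := sqrt_nonneg _
  have hπ := pi_pos
  have hσ0 : 0 < σ := lt_of_le_of_lt (by positivity) hσ
  have h1 : ν0 < 2 * π * σ := by
    rw [one_div, inv_mul_lt_iff₀ (by positivity)] at hσ
    exact hσ
  obtain ⟨ν, hν1, hν2⟩ := exists_between h1
  have hsq : -(a + 1 / 4) < ν ^ 2 := by
    have e : ν0 ^ 2 = max (-(a + 1 / 4)) 0 := sq_sqrt (le_max_right _ _)
    have : -(a + 1 / 4) ≤ ν0 ^ 2 := by rw [e]; exact le_max_left _ _
    nlinarith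
  set T := 1 / (2 * σ) with hT
  have hT0 : 0 < T := by positivity
  have hTν : ν * T < π := by
    rw [hT, mul_one_div, div_lt_iff₀ (by positivity)]
    linarith
  obtain ⟨R, hR1, hR⟩ := interval_lemma D (ν := ν) (θ := ν * T / 2) (by linarith)
    (by have : 0 ≤ ν := by linarith
        positivity) (by linarith) hsq
  have hC := D.Cpos
  refine ⟨R, σ * |log C| + 2, hR1, ?_⟩
  intro E hE1 hE
  have hEa : |E| = -E := abs_of_neg hE
  have hlogE : |log (|E|)| = -log (-E) := by
    rw [hEa, abs_of_nonpos]
    exact log_nonpos (by linarith) (by linarith)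
  set n := ⌈σ * (|log (|E|)| + |log C|)⌉₊ with hn
  have hn1 : σ * (|log (|E|)| + |log C|) ≤ n := Nat.le_ceil _
  have hn2 : (n : ℝ) < σ * (|log (|E|)| + |log C|) + 1 := Nat.ceil_lt_add_one (by positivity)
  set p : ℕ → ℝ := fun k => R * exp (k * T) with hp
  have hpR : ∀ k, R ≤ p k := by
    intro k
    have : 1 ≤ exp (k * T) := one_le_exp (by positivity)
    simp only [hp]
    nlinarith
  have hpmono : ∀ k, p k ≤ p (k + 1) := by
    intro k
    simp only [hp]
    gcongr
    simp
  have hlogp : ∀ k, log (p k) = log R + k * T := by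
    intro k
    simp only [hp]
    rw [log_mul (by linarith) (exp_pos _).ne', log_exp]
  refine ⟨(Finset.range (n + 1)).image p, ?_, ?_⟩
  · intro u hu hc hz
    have hV := D.contV
    have hU : Continuous (fun x => V x - E) := by fun_prop
    have huc := hu.continuous
    have hdc : Continuous (deriv u) := hu.continuous_deriv (by simp)
    have hzk : ∀ k ≤ n, u (p k) = 0 := fun k hk =>
      hz _ (Finset.mem_image_of_mem _ (Finset.mem_range.2 (by omega)))
    have hp0 : p 0 = R := by simp [hp]
    have hfirst := chain_intervals hU hu p n (fun k hk => by
      refine hR (p k) (p (k + 1)) (hpR k) (hpmono k) ?_ (fun x => V x - E) hU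
        (fun x => by linarith) u hu (hzk k (by omega)) (hzk _ (by omega))
      rw [hlogp, hlogp]
      push_cast
      apply le_of_eq
      ring)
    rw [hp0] at hfirst
    filter_upwards [eventually_ge_atTop (p n)] with b hb
    have hfc : Continuous (fun x => deriv u x ^ 2 + (V x - E) * u x ^ 2) := by fun_prop
    rw [← intervalIntegral.integral_add_adjacent_intervals (b := p n)
      (hfc.intervalIntegrable _ _) (hfc.intervalIntegrable _ _)]
    refine add_nonneg hfirst (intervalIntegral.integral_nonneg hb ?_)
    intro x hx
    have hx1 : 1 ≤ x := by linarith [hx.1, hpR n]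
    have hx0 : 0 < x := by linarith
    have hVx := (abs_le.1 (D.bV x hx1)).1
    have hbig : C / x ^ 2 ≤ -E := by
      rw [div_le_iff₀ (by positivity)]
      have l1 : log (p n) ≤ log x := log_le_log (by linarith [hpR n]) hx.1
      rw [hlogp] at l1
      have l2 : 0 ≤ log R := log_nonneg hR1
      have l3 : (|log (|E|)| + |log C|) ≤ 2 * (n * T) := by
        rw [hT]
        have : 2 * (n * (1 / (2 * σ))) = n / σ := by field_simp
        rw [this, le_div_iff₀ hσ0]
        linarith
      have l4 : log C ≤ log (-E * x ^ 2) := by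
        rw [log_mul (by linarith) (by positivity), log_pow]
        have := le_abs_self (log C)
        push_cast
        rw [hlogE] at l3
        linarith
      exact (log_le_log_iff hC (by nlinarith [sq_pos_of_pos hx0])).1 l4
    have : 0 ≤ V x - E := by linarith
    positivity
  · have hcard : ((Finset.range (n + 1)).image p).card ≤ n + 1 := by
      simpa using Finset.card_image_le (s := Finset.range (n + 1)) (f := p)
    have : (((Finset.range (n + 1)).image p).card : ℝ) ≤ n + 1 := by exact_mod_cast hcard
    linarith

lemma combine_good {V : ℝ → ℝ} (hV : Continuous V) {R R' : ℝ} (hR : 1 ≤ R) (hR' : 1 ≤ R') :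
    ∃ B : ℕ, ∀ E < 0, ∀ S S' : Finset ℝ, GoodSet V R E S → GoodSet (fun x => V (-x)) R' E S' →
      schN1 V E ≤ ((S.card + S'.card + B : ℕ) : ℕ∞) := by
  obtain ⟨S0, hS0⟩ := mid_region hV (-R') R (by linarith)
  refine ⟨S0.card, ?_⟩
  intro E hE S S' hS hS'
  classical
  refine (count_le_card V E ((S ∪ S'.image (fun x => -x)) ∪ S0) ?_).trans ?_
  · intro u hu hc hz
    have huc := hu.continuous
    have hdc : Continuous (deriv u) := hu.continuous_deriv (by simp)
    have hU : Continuous (fun x => V x - E) := by fun_prop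
    have hfc : Continuous (fun x => deriv u x ^ 2 + (V x - E) * u x ^ 2) := by fun_prop
    have h0 := hS0 (fun x => V x - E) hU (fun x => by linarith) u hu
      (fun x hx => hz x (by simp [hx]))
    have h1 := hS u hu hc (fun x hx => hz x (by simp [hx]))
    have h2 := hS' (fun x => u (-x)) (hu.comp contDiff_neg)
      (hc.comp_homeomorph (Homeomorph.neg ℝ))
      (fun x hx => hz (-x) (by simp [hx]))
    have hpos : 0 ≤ ∫ x, (deriv u x ^ 2 + (V x - E) * u x ^ 2) := by
      have ht := intervalIntegral_tendsto_integral
        (integrable_form hU hu hc) tendsto_neg_atTop_atBot tendsto_id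
      refine ge_of_tendsto ht ?_
      filter_upwards [h1, h2] with b hb1 hb2
      have e2 : (∫ x in R'..b, (deriv (fun x => u (-x)) x ^ 2 + (V (-x) - E) * u (-x) ^ 2)) =
          ∫ x in (-b)..(-R'), (deriv u x ^ 2 + (V x - E) * u x ^ 2) := by
        rw [← intervalIntegral.integral_comp_neg]
        simp [deriv_comp_neg]
      rw [e2] at hb2
      rw [← intervalIntegral.integral_add_adjacent_intervals (b := -R')
        (hfc.intervalIntegrable _ _) (hfc.intervalIntegrable _ _),
        ← intervalIntegral.integral_add_adjacent_intervals (a := -R') (b := R)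
        (hfc.intervalIntegrable _ _) (hfc.intervalIntegrable _ _)]
      simp only [id]
      linarith
    rw [form_shift E hV hu hc] at hpos
    linarith
  · have c1 := Finset.card_union_le (S ∪ S'.image (fun x => -x)) S0
    have c2 := Finset.card_union_le S (S'.image (fun x => -x))
    have c3 := Finset.card_image_le (s := S') (f := fun x : ℝ => -x)
    exact_mod_cast (by omega)

/-- One-dimensional profile: nearly optimal smooth Dirichlet test function on `(0,T)`. -/
lemma exists_profile {ν T : ℝ} (hν : 0 < ν) (hT : π / ν < T) :
    ∃ w : ℝ → ℝ, ContDiff ℝ (⊤ : ℕ∞) w ∧ (∀ s, s ∉ Ioo 0 T → w s = 0 ∧ deriv w s = 0) ∧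
      ∫ s in (0:ℝ)..T, deriv w s ^ 2 < ν ^ 2 * ∫ s in (0:ℝ)..T, w s ^ 2 := by
  have hπ := pi_pos
  have hT0 : 0 < T := lt_trans (by positivity) hT
  set μ := π / T with hμ
  have hμ0 : 0 < μ := by positivity
  have hμT : μ * T = π := by rw [hμ]; field_simp
  have hμν : μ < ν := by
    rw [hμ, div_lt_iff₀ hT0]
    rw [div_lt_iff₀ hν] at hT
    linarith
  have hsqlt : μ ^ 2 < ν ^ 2 := by gcongr
  set ε := (ν ^ 2 - μ ^ 2) / (8 * ν ^ 2) with hε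
  have hε0 : 0 < ε := div_pos (by linarith) (by positivity)
  have hε1 : ν ^ 2 * ε * 8 = ν ^ 2 - μ ^ 2 := by rw [hε]; field_simp
  set g : ℝ → ℝ := fun s => sin (μ * s) * expNegInvGlue (sin (μ * s) / ε) with hg
  have hgsm : ContDiff ℝ (⊤ : ℕ∞) g := by
    have h1 : ContDiff ℝ (⊤ : ℕ∞) (fun s : ℝ => sin (μ * s)) :=
      contDiff_sin.comp (contDiff_const.mul contDiff_id)
    exact h1.mul (expNegInvGlue.contDiff.comp (h1.div_const ε))
  have hgneg : ∀ s, sin (μ * s) ≤ 0 → g s = 0 := by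
    intro s hs
    simp only [hg]
    rw [expNegInvGlue.zero_of_nonpos (div_nonpos_of_nonpos_of_nonneg hs hε0.le), mul_zero]
  have hsinpos : ∀ s ∈ Ioo 0 T, 0 < sin (μ * s) := by
    intro s hs
    apply sin_pos_of_pos_of_lt_pi (by have := hs.1; positivity)
    rw [← hμT]
    exact mul_lt_mul_of_pos_left hs.2 hμ0
  set w : ℝ → ℝ := (Ioo 0 T).indicator g with hw
  have hwin : ∀ s ∈ Ioo 0 T, w s = g s := fun s hs => indicator_of_mem hs g
  have hwout : ∀ s, s ∉ Ioo 0 T → w s = 0 := fun s hs => indicator_of_notMem hs g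
  have hwl : ∀ s ∈ Ioo (-T) T, w s = g s := by
    intro s hs
    by_cases h : 0 < s
    · exact hwin s ⟨h, hs.2⟩
    · rw [hwout s (fun h' => h h'.1), hgneg]
      apply sin_nonpos_of_nonpos_of_neg_pi_le
      · nlinarith
      · rw [← hμT]; nlinarith [hs.1]
  have hwr : ∀ s ∈ Ioo 0 (2 * T), w s = g s := by
    intro s hs
    by_cases h : s < T
    · exact hwin s ⟨hs.1, h⟩
    · rw [hwout s (fun h' => h h'.2), hgneg]
      rw [← neg_nonneg, ← sin_sub_pi]
      apply sin_nonneg_of_nonneg_of_le_pi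
      · rw [← hμT]; nlinarith
      · nlinarith [hs.2]
  have hwsm : ContDiff ℝ (⊤ : ℕ∞) w := by
    rw [contDiff_iff_contDiffAt]
    intro s
    rcases lt_or_ge s 0 with h | h
    · refine (contDiffAt_const (c := (0:ℝ))).congr_of_eventuallyEq ?_
      filter_upwards [Iio_mem_nhds h] with y hy
      exact hwout y (fun h' => lt_asymm h'.1 hy)
    rcases lt_or_ge s T with h1 | h1
    · refine hgsm.contDiffAt.congr_of_eventuallyEq ?_
      filter_upwards [Ioo_mem_nhds (by linarith : -T < s) h1] with y hy
      exact hwl y hy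
    rcases lt_or_ge s (2 * T) with h2 | h2
    · refine hgsm.contDiffAt.congr_of_eventuallyEq ?_
      filter_upwards [Ioo_mem_nhds (by linarith : 0 < s) h2] with y hy
      exact hwr y hy
    · refine (contDiffAt_const (c := (0:ℝ))).congr_of_eventuallyEq ?_
      filter_upwards [Ioi_mem_nhds (by linarith : T < s)] with y hy
      exact hwout y (fun h' => lt_asymm h'.2 hy)
  have hwnn : ∀ s, 0 ≤ w s := by
    intro s
    by_cases h : s ∈ Ioo 0 T
    · rw [hwin s h]
      exact mul_nonneg (hsinpos s h).le (expNegInvGlue.nonneg _)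
    · rw [hwout s h]
  have hform : ∀ s ∈ Ioo 0 T, g s = sin (μ * s) * exp (-(ε / sin (μ * s))) := by
    intro s hs
    have h := hsinpos s hs
    simp only [hg]
    rw [expNegInvGlue, if_neg (not_le.2 (div_pos h hε0)), inv_div]
  have hder : ∀ s ∈ Ioo 0 T, deriv w s ^ 2 ≤ μ ^ 2 * cos (μ * s) ^ 2 := by
    intro s hs
    have h := hsinpos s hs
    have hev : w =ᶠ[𝓝 s] fun s => sin (μ * s) * exp (-(ε / sin (μ * s))) := by
      filter_upwards [Ioo_mem_nhds hs.1 hs.2] with y hy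
      rw [hwin y hy, hform y hy]
    have h1 : HasDerivAt (fun s => sin (μ * s)) (cos (μ * s) * μ) s := by
      have := (hasDerivAt_sin (μ * s)).comp s ((hasDerivAt_id s).const_mul μ)
      exact this.congr_deriv (by simp)
    have h2 := h1.mul ((((hasDerivAt_const s ε).div h1 h.ne').neg).exp)
    rw [hev.deriv_eq]
    have h3 := h2.deriv
    have e : deriv (fun s => sin (μ * s) * exp (-(ε / sin (μ * s)))) s =
        μ * cos (μ * s) * ((1 + ε / sin (μ * s)) * exp (-(ε / sin (μ * s)))) := by
      refine Eq.trans h3 ?_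
      simp only [Pi.neg_apply, Pi.div_apply]
      field_simp
      ring
    rw [e, mul_pow, mul_pow]
    set y := ε / sin (μ * s) with hy
    have hy0 : 0 ≤ y := by positivity
    have hb : (1 + y) * exp (-y) ≤ 1 := by
      rw [exp_neg, ← div_eq_mul_inv, div_le_one (exp_pos _)]
      linarith [add_one_le_exp y]
    have hb0 : 0 ≤ (1 + y) * exp (-y) := by positivity
    have : ((1 + y) * exp (-y)) ^ 2 ≤ 1 := pow_le_one₀ hb0 hb
    nlinarith [mul_nonneg (sq_nonneg μ) (sq_nonneg (cos (μ * s)))]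
  have hlow : ∀ s ∈ Ioo 0 T, sin (μ * s) ^ 2 - 2 * ε ≤ w s ^ 2 := by
    intro s hs
    have h := hsinpos s hs
    rw [hwin s hs, hform s hs, mul_pow, ← exp_nat_mul]
    have h1 := add_one_le_exp (((2:ℕ):ℝ) * -(ε / sin (μ * s)))
    have h2 : sin (μ * s) ^ 2 * (((2:ℕ):ℝ) * -(ε / sin (μ * s)) + 1) =
        sin (μ * s) ^ 2 - 2 * ε * sin (μ * s) := by
      push_cast; field_simp; ring
    have h3 := mul_le_mul_of_nonneg_left h1 (sq_nonneg (sin (μ * s)))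
    rw [h2] at h3
    nlinarith [sin_le_one (μ * s)]
  have hwc := hwsm.continuous
  have hdc : Continuous (deriv w) := hwsm.continuous_deriv (by simp)
  refine ⟨w, hwsm, ?_, ?_⟩
  · intro s hs
    refine ⟨hwout s hs, IsLocalMin.deriv_eq_zero ?_⟩
    refine Eventually.of_forall fun y => ?_
    rw [hwout s hs]
    exact hwnn y
  · have hcs : ∫ s in (0:ℝ)..T, cos (μ * s) ^ 2 = T / 2 := by
      rw [intervalIntegral.integral_comp_mul_left (fun y => cos y ^ 2) hμ0.ne', integral_cos_sq,
        hμT]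
      simp [hμ]
      field_simp
    have hsn : ∫ s in (0:ℝ)..T, sin (μ * s) ^ 2 = T / 2 := by
      rw [intervalIntegral.integral_comp_mul_left (fun y => sin y ^ 2) hμ0.ne', integral_sin_sq,
        hμT]
      simp [hμ]
      field_simp
    have i1 : ∫ s in (0:ℝ)..T, deriv w s ^ 2 ≤ ∫ s in (0:ℝ)..T, μ ^ 2 * cos (μ * s) ^ 2 := by
      apply intervalIntegral.integral_mono_on_of_le_Ioo hT0.le
      · exact Continuous.intervalIntegrable (by fun_prop) _ _
      · exact Continuous.intervalIntegrable (by fun_prop) _ _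
      · exact hder
    have i2 : ∫ s in (0:ℝ)..T, (sin (μ * s) ^ 2 - 2 * ε) ≤ ∫ s in (0:ℝ)..T, w s ^ 2 := by
      apply intervalIntegral.integral_mono_on_of_le_Ioo hT0.le
      · exact Continuous.intervalIntegrable (by fun_prop) _ _
      · exact Continuous.intervalIntegrable (by fun_prop) _ _
      · exact hlow
    rw [intervalIntegral.integral_const_mul, hcs] at i1
    rw [intervalIntegral.integral_sub (Continuous.intervalIntegrable (by fun_prop) _ _)
      (Continuous.intervalIntegrable (by fun_prop) _ _), hsn] at i2
    simp only [intervalIntegral.integral_const, smul_eq_mul, sub_zero] at i2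
    have i3 := mul_le_mul_of_nonneg_left i2 (sq_nonneg ν)
    nlinarith

set_option maxHeartbeats 2000000 in
/-- Scaled test function on the half line. -/
lemma half_test {V A A' : ℝ → ℝ} {a C : ℝ} (D : HalfData V A A' a C) {T : ℝ} {w : ℝ → ℝ}
    (hT : 0 < T)
    (hw : ContDiff ℝ (⊤ : ℕ∞) w) (hw0 : ∀ s, s ∉ Ioo 0 T → w s = 0 ∧ deriv w s = 0)
    (hlt : ∫ s in (0:ℝ)..T, deriv w s ^ 2 < (-(a + 1 / 4)) * ∫ s in (0:ℝ)..T, w s ^ 2) :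
    ∃ R δ : ℝ, 1 ≤ R ∧ 0 < δ ∧ ∀ ρ E : ℝ, R ≤ ρ → E < 0 → -E * (ρ * exp T) ^ 2 ≤ δ →
      ∃ u : ℝ → ℝ, ContDiff ℝ (⊤ : ℕ∞) u ∧ HasCompactSupport u ∧
        (∀ x, x ∉ Ioo ρ (ρ * exp T) → u x = 0 ∧ deriv u x = 0) ∧
        ∫ x, (deriv u x ^ 2 + (V x - E) * u x ^ 2) < 0 := by
  have hwc := hw.continuous
  have hwd : Continuous (deriv w) := hw.continuous_deriv (by simp)
  have hwD : ∀ s, HasDerivAt w (deriv w s) s := fun s =>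
    (hw.differentiable (by simp)).differentiableAt.hasDerivAt
  have hwz : w 0 = 0 := (hw0 0 (by simp)).1
  have hwT : w T = 0 := (hw0 T (by simp)).1
  set P := ∫ s in (0:ℝ)..T, (deriv w s + w s / 2) ^ 2 with hP
  set Q := ∫ s in (0:ℝ)..T, w s ^ 2 with hQ
  have hQ0 : 0 ≤ Q := intervalIntegral.integral_nonneg hT.le fun s _ => sq_nonneg _
  have hP0 : 0 ≤ P := intervalIntegral.integral_nonneg hT.le fun s _ => sq_nonneg _
  have hcross : ∫ s in (0:ℝ)..T, 2 * w s * deriv w s = 0 := by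
    rw [intervalIntegral.integral_eq_sub_of_hasDerivAt (f := fun s => w s ^ 2)]
    · simp [hwz, hwT]
    · intro s _
      refine ((hwD s).pow 2).congr_deriv (by simp)
    · exact Continuous.intervalIntegrable (by fun_prop) _ _
  have hPe : P = (∫ s in (0:ℝ)..T, deriv w s ^ 2) + 1 / 4 * Q := by
    have : P = ∫ s in (0:ℝ)..T,
        ((deriv w s ^ 2 + 1 / 4 * w s ^ 2) + 1 / 2 * (2 * w s * deriv w s)) := by
      rw [hP]; congr 1; ext s; ring
    rw [this, intervalIntegral.integral_add (Continuous.intervalIntegrable (by fun_prop) _ _)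
      (Continuous.intervalIntegrable (by fun_prop) _ _),
      intervalIntegral.integral_add (Continuous.intervalIntegrable (by fun_prop) _ _)
      (Continuous.intervalIntegrable (by fun_prop) _ _),
      intervalIntegral.integral_const_mul, intervalIntegral.integral_const_mul, hcross]
    ring
  have hneg : P + a * Q < 0 := by rw [hPe]; linarith
  set δ := -(P + a * Q) / (2 * (P + 3 * Q + 1)) with hδ
  have hδ0 : 0 < δ := div_pos (by linarith) (by positivity)
  have hδ1 : (1 + δ) * P + (a + 3 * δ) * Q < 0 := by
    have : δ * (2 * (P + 3 * Q + 1)) = -(P + a * Q) := by rw [hδ]; field_simp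
    nlinarith
  have hC := D.Cpos
  obtain ⟨R0, hR0⟩ := eventually_atTop.1
    (D.lim.eventually (gt_mem_nhds (by linarith : a < a + δ)))
  refine ⟨max (max R0 1) (C / δ), δ, le_max_of_le_left (le_max_right _ _), hδ0, ?_⟩
  intro ρ E hρ hE hEδ
  have hρ1 : 1 ≤ ρ := le_trans (le_max_of_le_left (le_max_right _ _)) hρ
  have hρR : R0 ≤ ρ := le_trans (le_max_of_le_left (le_max_left _ _)) hρ
  have hρC : C / δ ≤ ρ := le_trans (le_max_right _ _) hρ
  have hρ0 : 0 < ρ := by linarith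
  set β := ρ * exp T with hβ
  have hβρ : ρ ≤ β := by
    have : 1 ≤ exp T := one_le_exp hT.le
    rw [hβ]; nlinarith
  have hlogβ : log β = log ρ + T := by
    rw [hβ, log_mul hρ0.ne' (exp_pos _).ne', log_exp]
  set c := log ρ with hc
  set u : ℝ → ℝ := fun x => √x * w (log x - c) with hu
  have hmem : ∀ x, 0 < x → x ∉ Ioo ρ β → log x - c ∉ Ioo 0 T := by
    intro x hx hx' hcon
    apply hx'
    constructor
    · exact (log_lt_log_iff hρ0 hx).1 (by linarith [hcon.1])
    · exact (log_lt_log_iff hx (by linarith)).1 (by linarith [hcon.2])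
  have huout : ∀ x, x ∉ Ioo ρ β → u x = 0 := by
    intro x hx
    rcases le_or_gt x 0 with h | h
    · simp [hu, sqrt_eq_zero_of_nonpos h]
    · simp only [hu]
      rw [(hw0 _ (hmem x h hx)).1, mul_zero]
  have huD : ∀ x, 0 < x → HasDerivAt u
      ((deriv w (log x - c) + w (log x - c) / 2) / √x) x := by
    intro x hx
    have h1 := (hasDerivAt_sqrt hx.ne').mul
      ((hwD (log x - c)).comp x ((hasDerivAt_log hx.ne').sub_const c))
    refine h1.congr_deriv ?_
    have hs : 0 < √x := sqrt_pos.2 hx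
    have hss : x = √x * √x := (mul_self_sqrt hx.le).symm
    simp only [Function.comp]
    rw [hss]
    simp only [sqrt_mul_self hs.le]
    field_simp
    ring
  have husm : ContDiff ℝ (⊤ : ℕ∞) u := by
    rw [contDiff_iff_contDiffAt]
    intro x
    rcases lt_or_ge x ρ with h | h
    · refine (contDiffAt_const (c := (0:ℝ))).congr_of_eventuallyEq ?_
      filter_upwards [Iio_mem_nhds h] with y hy
      exact huout y (fun h' => lt_asymm h'.1 hy)
    · have hx : x ≠ 0 := by linarith
      exact (contDiffAt_sqrt hx).mul (hw.contDiffAt.comp x ((contDiffAt_log.2 hx).sub contDiffAt_const))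
  have hucs : HasCompactSupport u :=
    HasCompactSupport.intro (isCompact_Icc (a := ρ) (b := β))
      (fun x hx => huout x (fun h => hx (Ioo_subset_Icc_self h)))
  have hudout : ∀ x, x ∉ Ioo ρ β → deriv u x = 0 := by
    intro x hx
    rcases lt_or_ge x ρ with h | h
    · have : u =ᶠ[𝓝 x] fun _ => 0 := by
        filter_upwards [Iio_mem_nhds h] with y hy
        exact huout y (fun h' => lt_asymm h'.1 hy)
      rw [this.deriv_eq]; simp
    · have h0 : 0 < x := by linarith
      rw [(huD x h0).deriv, (hw0 _ (hmem x h0 hx)).1, (hw0 _ (hmem x h0 hx)).2]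
      simp
  refine ⟨u, husm, hucs, fun x hx => ⟨huout x hx, hudout x hx⟩, ?_⟩
  have huc := husm.continuous
  have hdc : Continuous (deriv u) := husm.continuous_deriv (by simp)
  have hV := D.contV
  have hA' := D.contA'
  have hA : Continuous A := continuous_iff_continuousAt.2 fun x => (D.diffA x).continuousAt
  have hfc : Continuous (fun x => deriv u x ^ 2 + (V x - E) * u x ^ 2) := by fun_prop
  have s1 : ∫ x, (deriv u x ^ 2 + (V x - E) * u x ^ 2) =
      ∫ x in ρ..β, (deriv u x ^ 2 + (V x - E) * u x ^ 2) := by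
    symm
    apply intervalIntegral.integral_eq_integral_of_support_subset
    intro x hx
    by_contra hcon
    apply hx
    have hx' : x ∉ Ioo ρ β := fun h => hcon ⟨h.1, h.2.le⟩
    simp [huout x hx', hudout x hx']
  have s2 : ∫ x in ρ..β, (A' x * u x ^ 2 + A x * (2 * u x * deriv u x)) = 0 := by
    rw [intervalIntegral.integral_eq_sub_of_hasDerivAt (f := fun s => A s * u s ^ 2)]
    · rw [huout β (by simp), huout ρ (by simp)]; simp
    · intro s _
      have hd : HasDerivAt u (deriv u s) s :=
        (husm.differentiable (by simp)).differentiableAt.hasDerivAt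
      refine ((D.diffA s).mul (hd.pow 2)).congr_deriv (by simp)
    · exact Continuous.intervalIntegrable (by fun_prop) _ _
  set G : ℝ → ℝ := fun s => (1 + δ) * (deriv w s + w s / 2) ^ 2 + (a + 3 * δ) * w s ^ 2 with hG
  have hGc : Continuous G := by rw [hG]; fun_prop
  have hGint : ∫ s in (0:ℝ)..T, G s < 0 := by
    have : ∫ s in (0:ℝ)..T, G s = (1 + δ) * P + (a + 3 * δ) * Q := by
      rw [hG, intervalIntegral.integral_add (Continuous.intervalIntegrable (by fun_prop) _ _)
        (Continuous.intervalIntegrable (by fun_prop) _ _),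
        intervalIntegral.integral_const_mul, intervalIntegral.integral_const_mul]
    linarith
  have hinv : ContinuousOn (fun x : ℝ => x⁻¹) (uIcc ρ β) := by
    rw [uIcc_of_le hβρ]
    exact continuousOn_inv₀.mono fun x hx => by
      have : ρ ≤ x := hx.1
      simp; linarith
  have hlogc : ContinuousOn (fun x : ℝ => log x - c) (uIcc ρ β) := by
    rw [uIcc_of_le hβρ]
    refine (continuousOn_log.mono fun x hx => ?_).sub continuousOn_const
    have : ρ ≤ x := hx.1
    simp; linarith
  have s3 : ∫ x in ρ..β, G (log x - c) * x⁻¹ = ∫ s in (0:ℝ)..T, G s := by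
    have := intervalIntegral.integral_comp_mul_deriv (a := ρ) (b := β) (f := fun x => log x - c)
      (f' := fun x => x⁻¹) (g := G)
      (fun x hx => by
        rw [uIcc_of_le hβρ] at hx
        have : ρ ≤ x := hx.1
        exact (hasDerivAt_log (by linarith)).sub_const c) hinv hGc
    have e1 : log ρ - c = 0 := by rw [hc]; ring
    have e2 : log β - c = T := by rw [hlogβ]; ring
    simp only [Function.comp, e1, e2] at this
    exact this
  have s4 : ∫ x in ρ..β, ((deriv u x ^ 2 + (V x - E) * u x ^ 2) -
      (A' x * u x ^ 2 + A x * (2 * u x * deriv u x))) ≤ ∫ x in ρ..β, G (log x - c) * x⁻¹ := by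
    apply intervalIntegral.integral_mono_on hβρ
    · exact Continuous.intervalIntegrable (by fun_prop) _ _
    · exact ContinuousOn.intervalIntegrable ((hGc.comp_continuousOn hlogc).mul hinv)
    · intro x hx
      have hx0 : 0 < x := by linarith [hx.1]
      have hs : 0 < √x := sqrt_pos.2 hx0
      have hss : √x ^ 2 = x := sq_sqrt hx0.le
      have hV1 := hR0 x (by linarith [hx.1])
      have hA1 : |x * A x| ≤ δ := by
        rw [abs_mul, abs_of_pos hx0]
        calc x * |A x| ≤ x * (C / x ^ 2) := by
              gcongr
              exact D.bA x (by linarith [hx.1])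
          _ = C / x := by field_simp
          _ ≤ δ := by
            rw [div_le_iff₀ hx0]
            have : C / δ ≤ x := by linarith [hx.1]
            rw [div_le_iff₀ hδ0] at this
            linarith
      have hE1 : -E * x ^ 2 ≤ δ := by
        refine le_trans ?_ hEδ
        have : x ^ 2 ≤ β ^ 2 := by gcongr; exact hx.2
        nlinarith
      set p := deriv u x with hp
      set z := u x / x with hz
      have hux : u x = z * x := by rw [hz]; field_simp
      have hp2 : (deriv w (log x - c) + w (log x - c) / 2) ^ 2 * x⁻¹ = p ^ 2 := by
        rw [hp, (huD x hx0).deriv, div_pow, hss]; field_simp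
      have hz2 : w (log x - c) ^ 2 * x⁻¹ = z ^ 2 := by
        rw [hz]; simp only [hu]; rw [div_pow, mul_pow, hss]; field_simp
      have hGx : G (log x - c) * x⁻¹ = (1 + δ) * p ^ 2 + (a + 3 * δ) * z ^ 2 := by
        rw [← hp2, ← hz2]; simp only [hG]; ring
      rw [hGx, hux]
      set y := x * A x with hy
      have e : p ^ 2 + (V x - E) * (z * x) ^ 2 - (A' x * (z * x) ^ 2 + A x * (2 * (z * x) * p)) =
          p ^ 2 + (x ^ 2 * (V x - A' x)) * z ^ 2 + (-E * x ^ 2) * z ^ 2 - y * (2 * z * p) := by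
        rw [hy]; ring
      rw [e]
      have k1 : (x ^ 2 * (V x - A' x)) * z ^ 2 ≤ (a + δ) * z ^ 2 := by gcongr
      have k2 : (-E * x ^ 2) * z ^ 2 ≤ δ * z ^ 2 := by gcongr
      have k3 : -(y * (2 * z * p)) ≤ δ * (z ^ 2 + p ^ 2) := by
        have hzp : |2 * z * p| ≤ z ^ 2 + p ^ 2 := by
          rw [abs_le]
          constructor <;> nlinarith [sq_nonneg (z - p), sq_nonneg (z + p)]
        calc -(y * (2 * z * p)) ≤ |y * (2 * z * p)| := neg_le_abs _
          _ = |y| * |2 * z * p| := abs_mul _ _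
          _ ≤ _ := by gcongr
      linarith
  rw [intervalIntegral.integral_sub (hfc.intervalIntegrable _ _)
    (Continuous.intervalIntegrable (by fun_prop) _ _), s2, s3] at s4
  rw [s1]
  linarith

lemma half_lower {V A A' : ℝ → ℝ} {a C : ℝ} (D : HalfData V A A' a C) {σ : ℝ}
    (hσ : σ < 1 / (2 * π) * √(max (-(a + 1 / 4)) 0)) :
    ∃ B : ℝ, ∀ E : ℝ, -1 < E → E < 0 → ∃ (n : ℕ) (u : Fin n → ℝ → ℝ),
      σ * |log (|E|)| - B ≤ n ∧ (∀ i, ContDiff ℝ (⊤ : ℕ∞) (u i)) ∧ (∀ i, HasCompactSupport (u i)) ∧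
      (∀ i j, i ≠ j → ∀ x, (u i x = 0 ∧ deriv (u i) x = 0) ∨ (u j x = 0 ∧ deriv (u j) x = 0)) ∧
      (∀ i x, x ≤ 0 → u i x = 0 ∧ deriv (u i) x = 0) ∧
      (∀ i, ∫ x, (deriv (u i) x ^ 2 + (V x - E) * u i x ^ 2) < 0) := by
  rcases le_or_gt σ 0 with hσ0 | hσ0
  · refine ⟨0, fun E _ _ => ⟨0, Fin.elim0, ?_, fun i => i.elim0, fun i => i.elim0,
      fun i => i.elim0, fun i => i.elim0, fun i => i.elim0⟩⟩
    have := abs_nonneg (log (|E|))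
    simp only [sub_zero, Nat.cast_zero]
    exact mul_nonpos_of_nonpos_of_nonneg hσ0 this
  have hπ := pi_pos
  set ν := √(max (-(a + 1 / 4)) 0) with hν
  have h1 : 2 * π * σ < ν := by
    rw [one_div, ← div_eq_inv_mul, lt_div_iff₀ (by positivity)] at hσ
    linarith
  have hν0 : 0 < ν := lt_trans (by positivity) h1
  have hν2 : ν ^ 2 = -(a + 1 / 4) := by
    have e : ν ^ 2 = max (-(a + 1 / 4)) 0 := sq_sqrt (le_max_right _ _)
    rcases max_choice (-(a + 1 / 4)) 0 with h | h
    · rw [e, h]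
    · rw [h] at e
      have := sq_pos_of_pos hν0
      linarith
  set T := 1 / (2 * σ) with hT
  have hT0 : 0 < T := by positivity
  have hTν : π / ν < T := by
    rw [hT, div_lt_div_iff₀ hν0 (by positivity)]
    linarith
  obtain ⟨w, hw, hw0, hlt⟩ := exists_profile hν0 hTν
  rw [hν2] at hlt
  obtain ⟨R, δ, hR, hδ, htest⟩ := half_test D hT0 hw hw0 hlt
  refine ⟨1 + σ * (2 * log R - log δ), ?_⟩
  intro E hE1 hE
  have hlogE : |log (|E|)| = -log (-E) := by
    rw [abs_of_neg hE, abs_of_nonpos]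
    exact log_nonpos (by linarith) (by linarith)
  set v := σ * (|log (|E|)| - 2 * log R + log δ) with hv
  set n := ⌊v⌋₊ with hn
  have hn1 : v < n + 1 := Nat.lt_floor_add_one v
  have hstep : ∀ i : Fin n, -E * (R * exp (i * T) * exp T) ^ 2 ≤ δ := by
    intro i
    have hi : ((i : ℕ) : ℝ) + 1 ≤ v := by
      have : ((i : ℕ) + 1) ≤ n := i.2
      have := (Nat.le_floor_iff' (by omega)).1 this
      exact_mod_cast this
    have hp : 0 < R * exp (i * T) * exp T := by positivity
    have hE' : 0 < -E := by linarith
    rw [← log_le_log_iff (by positivity) hδ, log_mul hE'.ne' (by positivity), log_pow,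
      log_mul (by positivity) (by positivity), log_mul (by positivity) (by positivity),
      log_exp, log_exp]
    have : 2 * (((i : ℕ) : ℝ) * T + T) ≤ |log (|E|)| - 2 * log R + log δ := by
      rw [hv] at hi
      have e : 2 * (((i : ℕ) : ℝ) * T + T) = (((i : ℕ) : ℝ) + 1) / σ := by
        rw [hT]; field_simp
      rw [e, div_le_iff₀ hσ0]
      linarith
    push_cast
    rw [hlogE] at this
    linarith
  have hRle : ∀ i : Fin n, R ≤ R * exp (i * T) := by
    intro i
    have : 1 ≤ exp (i * T) := one_le_exp (by positivity)
    nlinarith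
  choose u hu1 hu2 hu3 hu4 using fun i : Fin n => htest (R * exp (i * T)) E (hRle i) hE (hstep i)
  refine ⟨n, u, ?_, hu1, hu2, ?_, ?_, hu4⟩
  · rw [hv] at hn1
    linarith
  · have aux : ∀ i j : Fin n, i < j → ∀ x,
        x ∉ Ioo (R * exp (i * T)) (R * exp (i * T) * exp T) ∨
        x ∉ Ioo (R * exp (j * T)) (R * exp (j * T) * exp T) := by
      intro i j hij x
      by_contra hcon
      push Not at hcon
      have h1 := hcon.1.2
      have h2 := hcon.2.1
      have : R * exp (i * T) * exp T ≤ R * exp (j * T) := by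
        rw [mul_assoc, ← exp_add]
        gcongr
        have : ((i : ℕ) : ℝ) + 1 ≤ ((j : ℕ) : ℝ) := by exact_mod_cast hij
        nlinarith
      linarith
    intro i j hij x
    rcases lt_or_gt_of_ne hij with h | h
    · exact (aux i j h x).imp (hu3 i x) (hu3 j x)
    · exact ((aux j i h x).imp (hu3 j x) (hu3 i x)).symm
  · intro i x hx
    apply hu3 i x
    intro hcon
    linarith [hcon.1, hRle i]

lemma mk_data {W : ℝ → ℝ} (hW : SClass1 2 2 W)
    {η φ : ℝ → ℝ} {η₀ : ℝ} (hη : IsAdmissible1 η η₀ φ) {L1 Lm : ℝ}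
    (hL1 : Tendsto (fun r : ℝ => r ^ 2 * W r) atTop (𝓝 L1))
    (hLm : Tendsto (fun r : ℝ => r ^ 2 * W (-r)) atTop (𝓝 Lm)) :
    ∃ C : ℝ, HalfData (fun x => η x * W x) (fun x => deriv φ x * W x)
        (fun x => deriv (deriv φ) x * W x + deriv φ x * deriv W x) (η₀ * L1) C ∧
      HalfData (fun x => η (-x) * W (-x)) (fun x => -(deriv φ (-x) * W (-x)))
        (fun x => deriv (deriv φ) (-x) * W (-x) + deriv φ (-x) * deriv W (-x)) (η₀ * Lm) C := by
  obtain ⟨hWs, C, hC, hWb⟩ := hW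
  obtain ⟨M, hM⟩ := hη.bounded
  have hM0 : 0 ≤ M := (abs_nonneg _).trans (hM 0).1
  have hWc : Continuous W := hWs.continuous
  have hWd : ∀ x, HasDerivAt W (deriv W x) x := fun x =>
    (hWs.differentiable (by norm_num)).differentiableAt.hasDerivAt
  have hWdc : Continuous (deriv W) := hWs.continuous_deriv (by norm_num)
  have hφ1 : ContDiff ℝ 1 (deriv φ) := by
    have h := hη.smooth
    rw [show (2 : WithTop ℕ∞) = 1 + 1 by norm_num, contDiff_succ_iff_deriv] at h
    exact h.2.2
  have hφc : Continuous (deriv φ) := hφ1.continuous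
  have hφd : ∀ x, HasDerivAt (deriv φ) (deriv (deriv φ) x) x := fun x =>
    (hφ1.differentiable (by norm_num)).differentiableAt.hasDerivAt
  have hφ2c : Continuous (deriv (deriv φ)) := hφ1.continuous_deriv (by norm_num)
  have hηe : ∀ x, η x = η₀ + deriv (deriv φ) x := fun x => by rw [hη.poisson]; ring
  have hηc : Continuous η := by
    rw [funext hηe]; fun_prop
  have bW : ∀ x, 1 ≤ |x| → |W x| ≤ C / x ^ 2 := by
    intro x hx
    have h := hWb 0 (by norm_num) x
    simp only [iteratedDeriv_zero, Nat.cast_zero, sub_zero] at h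
    refine h.trans ?_
    rw [rpow_neg (by positivity), div_eq_mul_inv, ← sq_abs x]
    have : (1 + |x|) ^ (2 : ℝ) = (1 + |x|) ^ 2 := by exact_mod_cast rpow_natCast (1 + |x|) 2
    rw [this]
    gcongr
    linarith
  have bW' : ∀ x, 1 ≤ |x| → x ^ 2 * |deriv W x| ≤ C / |x| := by
    intro x hx
    have h := hWb 1 (by norm_num) x
    simp only [iteratedDeriv_one, Nat.cast_one] at h
    have e : (1 + |x|) ^ (-2 - 1 : ℝ) = ((1 + |x|) ^ 3)⁻¹ := by
      rw [show (-2 - 1 : ℝ) = -(3 : ℝ) by norm_num, rpow_neg (by positivity)]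
      congr 1
      exact_mod_cast rpow_natCast (1 + |x|) 3
    rw [e] at h
    have hx0 : 0 < |x| := by linarith
    have h2 : ((1 + |x|) ^ 3)⁻¹ ≤ (|x| ^ 3)⁻¹ := by gcongr; linarith
    calc x ^ 2 * |deriv W x| ≤ |x| ^ 2 * (C * (|x| ^ 3)⁻¹) := by
          rw [sq_abs]; gcongr; exact h.trans (by gcongr)
      _ = C / |x| := by field_simp
  set K := (|η₀| + M + 1) * C with hK
  have hK0 : 0 < K := by positivity
  have bAll : ∀ x t, 1 ≤ |x| → |t| ≤ |η₀| + M → |t * W x| ≤ K / x ^ 2 := by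
    intro x t hx ht
    rw [abs_mul]
    calc |t| * |W x| ≤ (|η₀| + M + 1) * (C / x ^ 2) := by
          gcongr
          · linarith
          · exact bW x hx
      _ = K / x ^ 2 := by rw [hK]; ring
  have bφ : ∀ x, |deriv φ x| ≤ |η₀| + M := fun x => by
    have := (hM x).2.1; have := abs_nonneg η₀; linarith
  have bη : ∀ x, |η x| ≤ |η₀| + M := fun x => by
    rw [hηe]
    exact (abs_add_le _ _).trans (by linarith [(hM x).2.2])
  have hsmall : ∀ f : ℝ → ℝ, (∀ r, 1 ≤ r → |f r| = r) →
      Tendsto (fun r => r ^ 2 * (deriv φ (f r) * deriv W (f r))) atTop (𝓝 0) := by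
    intro f hf
    have hz : Tendsto (fun r : ℝ => M * C / r) atTop (𝓝 0) := tendsto_const_nhds.div_atTop tendsto_id
    refine squeeze_zero_norm' ?_ hz
    filter_upwards [eventually_ge_atTop 1] with r hr
    have h1 := bW' (f r) (by rw [hf r hr]; exact hr)
    rw [← sq_abs, hf r hr] at h1
    rw [norm_eq_abs, abs_mul, abs_mul, abs_of_nonneg (sq_nonneg r)]
    calc r ^ 2 * (|deriv φ (f r)| * |deriv W (f r)|)
        = |deriv φ (f r)| * (r ^ 2 * |deriv W (f r)|) := by ring
      _ ≤ M * (C / r) := by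
        gcongr
        exact (hM _).2.1
      _ = M * C / r := by ring
  refine ⟨K, ⟨by fun_prop, ?_, by fun_prop, hK0, ?_, ?_, ?_⟩,
    ⟨by fun_prop, ?_, by fun_prop, hK0, ?_, ?_, ?_⟩⟩
  · intro x
    exact (hφd x).mul (hWd x)
  · intro x hx
    exact bAll x _ (by rwa [abs_of_nonneg (by linarith)]) (bφ x)
  · intro x hx
    exact bAll x _ (by rwa [abs_of_nonneg (by linarith)]) (bη x)
  · have := (hL1.const_mul η₀).sub (hsmall (fun r => r) (fun r hr => abs_of_nonneg (by linarith)))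
    rw [sub_zero] at this
    refine this.congr fun x => ?_
    rw [hηe]; ring
  · intro x
    have h := ((hφd (-x)).mul (hWd (-x))).comp x (hasDerivAt_neg x)
    refine h.neg.congr_deriv ?_
    ring
  · intro x hx
    rw [abs_neg, ← neg_sq x]
    exact bAll (-x) _ (by rwa [abs_neg, abs_of_nonneg (by linarith)]) (bφ (-x))
  · intro x hx
    rw [← neg_sq x]
    exact bAll (-x) _ (by rwa [abs_neg, abs_of_nonneg (by linarith)]) (bη (-x))
  · have := (hLm.const_mul η₀).sub
      (hsmall (fun r => -r) (fun r hr => by rw [abs_neg, abs_of_nonneg (by linarith)]))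
    rw [sub_zero] at this
    refine this.congr fun x => ?_
    rw [hηe]; ring

lemma lower_both {V A A' B B' : ℝ → ℝ} {a b C : ℝ} (hV : Continuous V)
    (D : HalfData V A A' a C) (D' : HalfData (fun x => V (-x)) B B' b C) {σ σ' : ℝ}
    (hσ : σ < 1 / (2 * π) * √(max (-(a + 1 / 4)) 0))
    (hσ' : σ' < 1 / (2 * π) * √(max (-(b + 1 / 4)) 0)) :
    ∃ K : ℝ, ∀ E : ℝ, -1 < E → E < 0 → ∃ n : ℕ, (σ + σ') * |log (|E|)| - K ≤ n ∧
      (n : ℕ∞) ≤ schN1 V E := by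
  obtain ⟨K1, h1⟩ := half_lower D hσ
  obtain ⟨K2, h2⟩ := half_lower D' hσ'
  refine ⟨K1 + K2, ?_⟩
  intro E hE1 hE
  obtain ⟨n, u, hn, u1, u2, u3, u4, u5⟩ := h1 E hE1 hE
  obtain ⟨m, v, hm, v1, v2, v3, v4, v5⟩ := h2 E hE1 hE
  refine ⟨n + m, by push_cast; linarith, ?_⟩
  have hdv : ∀ i x, deriv (fun y => v i (-y)) x = -deriv (v i) (-x) := fun i x =>
    deriv_comp_neg (v i) x
  have := card_le_count V hV E (ι := Fin n ⊕ Fin m)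
    (Sum.elim u (fun i x => v i (-x))) ?_ ?_ ?_ ?_
  · simpa using this
  · rintro (i | i)
    · exact u1 i
    · exact (v1 i).comp contDiff_neg
  · rintro (i | i)
    · exact u2 i
    · exact (v2 i).comp_homeomorph (Homeomorph.neg ℝ)
  · rintro (i | i) (j | j) hij x
    · exact u3 i j (fun h => hij (by rw [h])) x
    · simp only [Sum.elim_inl, Sum.elim_inr, hdv, neg_eq_zero]
      rcases le_total x 0 with h | h
      · exact Or.inl (u4 i x h)
      · exact Or.inr (v4 j (-x) (by linarith))
    · simp only [Sum.elim_inl, Sum.elim_inr, hdv, neg_eq_zero]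
      rcases le_total x 0 with h | h
      · exact Or.inr (u4 j x h)
      · exact Or.inl (v4 i (-x) (by linarith))
    · simp only [Sum.elim_inr, hdv, neg_eq_zero]
      exact v3 i j (fun h => hij (by rw [h])) (-x)
  · rintro (i | i)
    · exact u5 i
    · simp only [Sum.elim_inr, hdv]
      refine lt_of_eq_of_lt ?_ (v5 i)
      rw [← integral_neg_eq_self]
      simp

lemma final_limit {V A A' B B' : ℝ → ℝ} {a b C : ℝ} (hV : Continuous V)
    (D : HalfData V A A' a C) (D' : HalfData (fun x => V (-x)) B B' b C) :
    (∀ᶠ E in 𝓝[<] (0 : ℝ), schN1 V E ≠ ⊤) ∧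
      Tendsto (fun E : ℝ => ((schN1 V E).toNat : ℝ) / |Real.log (|E|)|) (𝓝[<] 0)
        (𝓝 ((1 / (2 * π)) * (√(max (-(a + 1 / 4)) 0) + √(max (-(b + 1 / 4)) 0)))) := by
  set s := 1 / (2 * π) * √(max (-(a + 1 / 4)) 0) with hs
  set s' := 1 / (2 * π) * √(max (-(b + 1 / 4)) 0) with hs'
  rw [mul_add, ← hs, ← hs']
  have hnear : ∀ᶠ E in 𝓝[<] (0 : ℝ), -1 < E ∧ E < 0 :=
    Ioo_mem_nhdsLT (by norm_num : (-1 : ℝ) < 0)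
  have hlog : Tendsto (fun E : ℝ => |log (|E|)|) (𝓝[<] 0) atTop := by
    simp_rw [log_abs]
    exact tendsto_abs_atBot_atTop.comp (tendsto_log_nhdsLT_zero)
  have hup : ∀ ε > 0, ∃ K : ℝ, ∀ E : ℝ, -1 < E → E < 0 → schN1 V E ≠ ⊤ ∧
      ((schN1 V E).toNat : ℝ) ≤ (s + s' + ε) * |log (|E|)| + K := by
    intro ε hε
    obtain ⟨R, K1, hR, h1⟩ := good_log D (σ := s + ε / 2) (by linarith)
    obtain ⟨R', K2, hR', h2⟩ := good_log D' (σ := s' + ε / 2) (by linarith)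
    obtain ⟨N, hN⟩ := combine_good hV hR hR'
    refine ⟨K1 + K2 + N, fun E hE1 hE => ?_⟩
    obtain ⟨S, hS, hSc⟩ := h1 E hE1 hE
    obtain ⟨S', hS', hSc'⟩ := h2 E hE1 hE
    have h := hN E hE S S' hS hS'
    refine ⟨ne_top_of_le_ne_top (ENat.coe_ne_top _) h, ?_⟩
    have h3 : (schN1 V E).toNat ≤ S.card + S'.card + N := ENat.toNat_le_of_le_coe h
    have h4 : ((schN1 V E).toNat : ℝ) ≤ S.card + S'.card + N := by exact_mod_cast h3
    linarith
  have hlow : ∀ ε > 0, ∃ K : ℝ, ∀ E : ℝ, -1 < E → E < 0 → 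
      (s + s' - ε) * |log (|E|)| - K ≤ ((schN1 V E).toNat : ℝ) := by
    intro ε hε
    obtain ⟨K0, h0⟩ := hup 1 one_pos
    obtain ⟨K, h1⟩ := lower_both hV D D' (σ := s - ε / 2) (σ' := s' - ε / 2) (by linarith)
      (by linarith)
    refine ⟨K, fun E hE1 hE => ?_⟩
    obtain ⟨n, hn, hn2⟩ := h1 E hE1 hE
    have h3 : n ≤ (schN1 V E).toNat := by
      rw [← ENat.coe_toNat (h0 E hE1 hE).1] at hn2
      exact_mod_cast hn2
    have h4 : (n : ℝ) ≤ (schN1 V E).toNat := by exact_mod_cast h3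
    linarith
  constructor
  · obtain ⟨K0, h0⟩ := hup 1 one_pos
    filter_upwards [hnear] with E hE
    exact (h0 E hE.1 hE.2).1
  · rw [Metric.tendsto_nhds]
    intro ε hε
    obtain ⟨K1, h1⟩ := hup (ε / 3) (by positivity)
    obtain ⟨K2, h2⟩ := hlow (ε / 3) (by positivity)
    filter_upwards [hnear, hlog.eventually_gt_atTop 0,
      hlog.eventually_gt_atTop ((|K1| + |K2|) / (ε / 3))] with E hE hl hl2
    rw [div_lt_iff₀ (by positivity)] at hl2
    have a1 := (h1 E hE.1 hE.2).2
    have a2 := h2 E hE.1 hE.2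
    have := le_abs_self K1
    have := le_abs_self K2
    have := abs_nonneg K1
    have := abs_nonneg K2
    rw [dist_eq, abs_lt]
    constructor
    · rw [lt_sub_iff_add_lt, lt_div_iff₀ hl]
      nlinarith
    · rw [sub_lt_iff_lt_add, div_lt_iff₀ hl]
      nlinarith

/-- Theorem 3.1 (iii) for `d = 1`: logarithmic eigenvalue asymptotics in the border case
`ρ = 2`, and finiteness of the discrete spectrum when `λ₁(η₀ L) > -1/4`. -/
theorem eigenvalue_asymptotics_border_case_dim_one
    (W : ℝ → ℝ) (hW : SClass1 2 2 W)
    (η φ : ℝ → ℝ) (η₀ : ℝ) (hη : IsAdmissible1 η η₀ φ)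
    (L1 Lm : ℝ)
    (hL1 : Tendsto (fun r : ℝ => r ^ 2 * W r) atTop (𝓝 L1))
    (hLm : Tendsto (fun r : ℝ => r ^ 2 * W (-r)) atTop (𝓝 Lm)) :
    ((∀ᶠ E in 𝓝[<] (0 : ℝ), schN1 (fun x => η x * W x) E ≠ ⊤) ∧
      Tendsto (fun E : ℝ =>
          ((schN1 (fun x => η x * W x) E).toNat : ℝ) / |Real.log (|E|)|)
        (𝓝[<] 0)
        (𝓝 ((1 / (2 * π)) *
          (Real.sqrt (max (-(η₀ * L1 + 1 / 4)) 0) +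
            Real.sqrt (max (-(η₀ * Lm + 1 / 4)) 0))))) ∧
    (-(1 / 4 : ℝ) < min (η₀ * L1) (η₀ * Lm) →
      (⨆ E ∈ Set.Iio (0 : ℝ), schN1 (fun x => η x * W x) E) < ⊤) := by
  obtain ⟨C, D, D'⟩ := mk_data hW hη hL1 hLm
  have hV := D.contV
  set V : ℝ → ℝ := fun x => η x * W x with hVdef
  refine ⟨final_limit hV D D', ?_⟩
  intro hmin
  obtain ⟨R, hR1, hR⟩ := good_hardy D (lt_of_lt_of_le hmin (min_le_left _ _))
  obtain ⟨R', hR1', hR'⟩ := good_hardy D' (lt_of_lt_of_le hmin (min_le_right _ _))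
  obtain ⟨B, hB⟩ := combine_good hV hR1 hR1'
  refine lt_of_le_of_lt (iSup₂_le fun E hE => hB E hE {R} {R'} (hR E hE) (hR' E hE)) ?_
  exact ENat.coe_lt_top _

end
end

section
/- Let d = 1. Let η = η̃ be admissible with mean value 0, with φ the C² bounded solution of φ'' = η̃. Suppose ψ := (φ')² is admissible with mean value ψ₀ > 0, and that φ' itself is admissible (with mean value 0). Let W ∈ S_{3,1}(ℝ), and suppose there exist 𝓛(1), 𝓛(-1) ∈ ℝ with lim_{r→+∞} r²W(rω)² = 𝓛(ω) for ω ∈ {+1,-1}. Then lim_{E↑0} (|ln|E||)^{-1} N(E; ηW) = (1/(2π)) [ (-ψ₀𝓛(1) + 1/4)_-^{1/2} + (-ψ₀𝓛(-1) + 1/4)_-^{1/2} ]. If, moreover, min{-ψ₀𝓛(1), -ψ₀𝓛(-1)} > -1/4, then sup_{E<0} N(E; ηW) < ∞. -/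
open MeasureTheory Filter Real Set Topology

noncomputable section

section Aux


/-! ### Riccati lower bounds -/

/-- Nonnegativity of the shifted form on `[a,b]` for `C¹` functions vanishing on `S`. -/
def NN (V : ℝ → ℝ) (E a b : ℝ) (S : Finset ℝ) : Prop :=
  ∀ u : ℝ → ℝ, ContDiff ℝ 1 u → (∀ s ∈ S, u s = 0) →
    0 ≤ ∫ x in a..b, (deriv u x ^ 2 + (V x - E) * u x ^ 2)

lemma form_cont {V u : ℝ → ℝ} (hV : Continuous V) (hu : ContDiff ℝ 1 u) (E : ℝ) :
    Continuous (fun x => deriv u x ^ 2 + (V x - E) * u x ^ 2) := by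
  have h1 : Continuous (deriv u) := hu.continuous_deriv le_rfl
  have h2 : Continuous u := hu.continuous
  fun_prop

lemma NN.mono {V : ℝ → ℝ} {E a b : ℝ} {S T : Finset ℝ} (h : NN V E a b S) (hST : S ⊆ T) :
    NN V E a b T := fun u hu hs => h u hu (fun s hs' => hs s (hST hs'))

lemma NN.trans {V : ℝ → ℝ} (hV : Continuous V) {E a b c : ℝ} {S T : Finset ℝ}
    (h : NN V E a b S) (h' : NN V E b c T) : NN V E a c (S ∪ T) := by
  intro u hu hs
  have hc := form_cont hV hu E
  rw [← intervalIntegral.integral_add_adjacent_intervals (b := b)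
    (hc.intervalIntegrable _ _) (hc.intervalIntegrable _ _)]
  exact add_nonneg (h u hu fun s hs' => hs s (Finset.mem_union_left _ hs'))
    (h' u hu fun s hs' => hs s (Finset.mem_union_right _ hs'))

lemma NN.chain {V : ℝ → ℝ} (hV : Continuous V) {E : ℝ} (x : ℕ → ℝ) (n : ℕ)
    (h : ∀ k < n, NN V E (x k) (x (k + 1)) {x k, x (k + 1)}) :
    NN V E (x 0) (x n) ((Finset.range (n + 1)).image x) := by
  intro u hu hs
  have hc := form_cont hV hu E
  rw [← intervalIntegral.sum_integral_adjacent_intervals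
    (fun k _ => hc.intervalIntegrable _ _)]
  refine Finset.sum_nonneg fun k hk => h k (Finset.mem_range.1 hk) u hu ?_
  have hk := Finset.mem_range.1 hk
  intro s hs'
  simp only [Finset.mem_insert, Finset.mem_singleton] at hs'
  refine hs s (Finset.mem_image.2 ?_)
  rcases hs' with rfl | rfl
  · exact ⟨k, by simp; omega, rfl⟩
  · exact ⟨k + 1, by simp; omega, rfl⟩

lemma NN.neg {V : ℝ → ℝ} {E a b : ℝ} {S : Finset ℝ}
    (h : NN (fun x => V (-x)) E a b S) : NN V E (-b) (-a) (S.image (fun x => -x)) := by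
  intro u hu hs
  have := h (fun x => u (-x)) (hu.comp contDiff_neg) (fun s hs' => hs _
    (Finset.mem_image_of_mem _ hs'))
  have e : ∀ x, deriv (fun x => u (-x)) x = - deriv u (-x) := fun x => deriv_comp_neg u x
  simp only [e, neg_sq] at this
  rwa [intervalIntegral.integral_comp_neg
    (fun x => deriv u x ^ 2 + (V x - E) * u x ^ 2)] at this

lemma NN.riccati {V : ℝ → ℝ} (hV : Continuous V) {E a b : ℝ} (hab : a ≤ b)
    (h h1 : ℝ → ℝ) (hd : ∀ x ∈ Icc a b, HasDerivAt h (h1 x) x)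
    (hle : ∀ x ∈ Icc a b, h1 x + h x ^ 2 ≤ V x - E) : NN V E a b {a, b} := by
  intro u hu hs
  have hua : u a = 0 := hs a (by simp)
  have hub : u b = 0 := hs b (by simp)
  have hc := form_cont hV hu E
  have hdu : ∀ x, HasDerivAt u (deriv u x) x := fun x =>
    ((hu.differentiable one_ne_zero) x).hasDerivAt
  have hg : ∀ x ∈ Icc a b, HasDerivAt (fun x => h x * u x ^ 2)
      (h1 x * u x ^ 2 + h x * (2 * u x * deriv u x)) x := by
    intro x hx
    refine ((hd x hx).mul ((hdu x).pow 2)).congr_deriv ?_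
    simp
  have := intervalIntegral.sub_le_integral_of_hasDeriv_right_of_le hab
    (g := fun x => h x * u x ^ 2)
    (g' := fun x => h1 x * u x ^ 2 + h x * (2 * u x * deriv u x))
    (φ := fun x => deriv u x ^ 2 + (V x - E) * u x ^ 2)
    (fun x hx => (hg x hx).continuousAt.continuousWithinAt)
    (fun x hx => (hg x (Ioo_subset_Icc_self hx)).hasDerivWithinAt)
    (hc.integrableOn_Icc)
    (fun x hx => by
      have := hle x (Ioo_subset_Icc_self hx)
      nlinarith [sq_nonneg (deriv u x - h x * u x),
        mul_le_mul_of_nonneg_right this (sq_nonneg (u x))])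
  simpa [hua, hub] using this

/-- Middle region. -/
lemma NN.middle {V : ℝ → ℝ} (hV : Continuous V) {a b : ℝ} (hab : a < b) :
    ∃ S : Finset ℝ, ∀ E ≤ 0, NN V E a b S := by
  obtain ⟨m0, hm0⟩ := (isCompact_Icc (a := a) (b := b)).bddBelow_image hV.continuousOn
  set ν : ℝ := |m0| + 1 with hν
  have hνpos : 0 < ν := by positivity
  have hm : ∀ x ∈ Icc a b, -ν ^ 2 ≤ V x := by
    intro x hx
    have h1 : m0 ≤ V x := hm0 ⟨x, hx, rfl⟩
    have h2 := neg_abs_le m0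
    nlinarith [abs_nonneg m0]
  obtain ⟨n, hn⟩ := exists_nat_gt ((b - a) * ν / 2)
  have hba : 0 < b - a := by linarith
  have hn0 : (0 : ℝ) < n := lt_of_le_of_lt (by positivity) hn
  set l : ℝ := (b - a) / n with hl
  have hlpos : 0 < l := by positivity
  have hnl : n * l = b - a := by rw [hl]; field_simp
  have hlν : ν * l < 2 := by
    rw [hl, ← mul_div_assoc, div_lt_iff₀ hn0]; linarith
  refine ⟨(Finset.range (n + 1)).image (fun k : ℕ => a + k * l), fun E hE => ?_⟩
  have key := NN.chain hV (E := E) (fun k : ℕ => a + k * l) n ?_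
  · simpa [hnl] using key
  · intro k hk
    have hk' : ((k : ℝ) + 1) ≤ n := by exact_mod_cast hk
    set c : ℝ := a + k * l + l / 2 with hc
    have hsub : ∀ x ∈ Icc (a + k * l) (a + ((k + 1 : ℕ) : ℝ) * l),
        0 < cos (ν * (x - c)) := by
      intro x hx
      obtain ⟨hx1, hx2⟩ := hx
      push_cast at hx2
      have hpi := pi_gt_three
      apply cos_pos_of_mem_Ioo
      constructor <;> nlinarith
    refine NN.riccati hV (by push_cast; nlinarith) (fun x => -ν * tan (ν * (x - c)))
      (fun x => -ν * (1 / cos (ν * (x - c)) ^ 2 * ν)) ?_ ?_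
    · intro x hx
      have h0 := (hsub x hx).ne'
      have h1 : HasDerivAt (fun x => ν * (x - c)) ν x := by
        simpa using ((hasDerivAt_id x).sub_const c).const_mul ν
      exact ((Real.hasDerivAt_tan h0).comp x h1).const_mul (-ν)
    · intro x hx
      have h0 := (hsub x hx).ne'
      have hxab : x ∈ Icc a b := by
        obtain ⟨hx1, hx2⟩ := hx
        push_cast at hx2
        have : ((k : ℝ) + 1) * l ≤ n * l := by gcongr
        have h3 : 0 ≤ (k : ℝ) * l := by positivity
        constructor <;> linarith
      have h2 := hm x hxab
      have e : -ν * (1 / cos (ν * (x - c)) ^ 2 * ν) + (-ν * tan (ν * (x - c))) ^ 2 = -ν ^ 2 := by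
        rw [tan_eq_sin_div_cos]
        field_simp
        linear_combination sin_sq_add_cos_sq (ν * (x - c))
      linarith

/-- Counting bound from point constraints. -/
lemma schN1_le {V : ℝ → ℝ} {E : ℝ} (S : Finset ℝ)
    (h : ∀ u : ℝ → ℝ, ContDiff ℝ (⊤ : ℕ∞) u → HasCompactSupport u → (∀ s ∈ S, u s = 0) →
      E * ∫ x, u x ^ 2 ≤ ∫ x, (deriv u x ^ 2 + V x * u x ^ 2)) :
    schN1 V E ≤ S.card := by
  refine iSup_le ?_
  rintro ⟨F, hF1, hF2⟩
  simp only [Nat.cast_le]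
  let T : F →ₗ[ℝ] (S → ℝ) :=
    { toFun := fun u s => u.1 s.1
      map_add' := fun u v => by ext; simp
      map_smul' := fun c v => by ext; simp }
  have hinj : Function.Injective T := by
    rw [← LinearMap.ker_eq_bot, LinearMap.ker_eq_bot']
    rintro ⟨u, hu⟩ hT
    by_contra hne
    have hne' : u ≠ 0 := fun h0 => hne (Subtype.ext h0)
    have h1 := hF2 u hu hne'
    have h2 := h u (hF1 u hu).1 (hF1 u hu).2 (fun s hs => congrFun hT ⟨s, hs⟩)
    exact absurd h1 (not_lt.2 h2)
  have := LinearMap.finrank_le_finrank_of_injective hinj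
  simpa using this

lemma form_split {V u : ℝ → ℝ} (hV : Continuous V) (hu : ContDiff ℝ 1 u)
    (hc : HasCompactSupport u) (E : ℝ) :
    ∫ x, (deriv u x ^ 2 + (V x - E) * u x ^ 2) =
      (∫ x, (deriv u x ^ 2 + V x * u x ^ 2)) - E * ∫ x, u x ^ 2 := by
  have h1 : Continuous (deriv u) := hu.continuous_deriv le_rfl
  have h2 : Continuous u := hu.continuous
  have hcd : HasCompactSupport (deriv u) := hc.deriv
  have i1 : Integrable (fun x => deriv u x ^ 2 + V x * u x ^ 2) := by
    apply Continuous.integrable_of_hasCompactSupport (by fun_prop)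
    refine HasCompactSupport.add (f := fun x => deriv u x ^ 2) (f' := fun x => V x * u x ^ 2) ?_ ?_
    · exact hcd.comp_left (g := fun y => y ^ 2) (by simp)
    · exact (hc.comp_left (g := fun y : ℝ => y ^ 2) (by simp)).mul_left
  have i2 : Integrable (fun x => u x ^ 2) := by
    apply Continuous.integrable_of_hasCompactSupport (by fun_prop)
    exact (hc.comp_left (g := fun y : ℝ => y ^ 2) (by simp))
  rw [← integral_const_mul, ← integral_sub i1 (i2.const_mul E)]
  congr 1
  ext x; ring

/-- Assemble the upper bound. -/
lemma schN1_le_of_pieces {V : ℝ → ℝ} (hV : Continuous V) {E R1 R2 : ℝ}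
    (S1 S2 S3 : Finset ℝ)
    (h1 : ∃ B, ∀ b ≥ B, NN V E R1 b (insert b S1))
    (h2 : ∃ B, ∀ b ≥ B, NN (fun x => V (-x)) E R2 b (insert b S2))
    (h3 : NN V E (-R2) R1 S3) :
    schN1 V E ≤ (S1.card + S2.card + S3.card : ℕ) := by
  classical
  obtain ⟨B1, h1⟩ := h1
  obtain ⟨B2, h2⟩ := h2
  refine (schN1_le (S1 ∪ S2.image (fun x => -x) ∪ S3) ?_).trans ?_
  · intro u hu hc hS
    have hu1 : ContDiff ℝ 1 u := hu.of_le (by exact_mod_cast le_top)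
    obtain ⟨r, hr⟩ := hc.isBounded.subset_closedBall 0
    set b : ℝ := max (max B1 B2) (|r| + 1) with hb
    have hbr : |r| + 1 ≤ b := le_max_right _ _
    have hb0 : 0 < b := by have := abs_nonneg r; linarith
    have hzero : ∀ x, b ≤ |x| → u x = 0 := by
      intro x hx
      by_contra hne
      have := hr (subset_tsupport u hne)
      simp only [Metric.mem_closedBall, dist_zero_right, Real.norm_eq_abs] at this
      have := le_abs_self r
      linarith
    have hub : u b = 0 := hzero b (le_abs_self b)
    have hub' : u (-b) = 0 := hzero (-b) (by rw [abs_neg]; exact le_abs_self b)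
    have k1 := h1 b (le_trans (le_max_left _ _) (le_max_left _ _))
    have k2 := (h2 b (le_trans (le_max_right _ _) (le_max_left _ _))).neg
    have key := (k2.trans hV (h3.trans hV k1)) u hu1 (by
      intro s hs
      simp only [Finset.mem_union, Finset.mem_image, Finset.mem_insert] at hs hS
      rcases hs with ⟨y, rfl | hy, rfl⟩ | hs | rfl | hs
      · exact hub'
      · exact hS _ (Or.inl (Or.inr ⟨y, hy, rfl⟩))
      · exact hS _ (Or.inr hs)
      · exact hub
      · exact hS _ (Or.inl (Or.inl hs)))
    have e := form_split hV hu1 hc E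
    rw [← sub_nonneg, ← e]
    rwa [intervalIntegral.integral_eq_integral_of_support_subset] at key
    intro x hx
    have : x ∈ tsupport u := by
      by_contra hx'
      have a1 : u x = 0 := image_eq_zero_of_notMem_tsupport hx'
      have a2 : deriv u x = 0 := by
        by_contra hne
        exact hx' (support_deriv_subset hne)
      simp [a1, a2] at hx
    have := hr this
    simp only [Metric.mem_closedBall, dist_zero_right, Real.norm_eq_abs] at this
    have h5 := abs_le.1 this
    have := le_abs_self r
    constructor <;> linarith
  · have c1 := Finset.card_union_le (S1 ∪ S2.image (fun x => -x)) S3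
    have c2 := Finset.card_union_le S1 (S2.image (fun x => -x))
    have c3 : (S2.image (fun x => -x)).card ≤ S2.card := Finset.card_image_le
    exact Nat.cast_le.2 (by omega)

/-! ### Half-line data -/

structure HL (V φ f f1 X W W1 W2 : ℝ → ℝ) (ψ C L : ℝ) : Prop where
  Vc : Continuous V
  V_eq : ∀ x, V x = f1 x * W x
  dφ : ∀ x, HasDerivAt φ (f x) x
  df : ∀ x, HasDerivAt f (f1 x) x
  dX : ∀ x, HasDerivAt X (f x ^ 2 - ψ) x
  dW : ∀ x, HasDerivAt W (W1 x) x
  dW1 : ∀ x, HasDerivAt W1 (W2 x) x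
  C0 : 0 ≤ C
  bφ : ∀ x, |φ x| ≤ C
  bf : ∀ x, |f x| ≤ C
  bX : ∀ x, |X x| ≤ C
  bW : ∀ x, 1 ≤ x → |W x * x| ≤ C
  bW1 : ∀ x, 1 ≤ x → |W1 x * x ^ 2| ≤ C
  bW2 : ∀ x, 1 ≤ x → |W2 x * x ^ 3| ≤ C
  lim : Tendsto (fun x => x ^ 2 * W x ^ 2) atTop (𝓝 L)

lemma amul {a b A B : ℝ} (h : |a| ≤ A) (h' : |b| ≤ B) : |a * b| ≤ A * B := by
  rw [abs_mul]
  exact mul_le_mul h h' (abs_nonneg _) ((abs_nonneg _).trans h)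

lemma aadd {a b A B : ℝ} (h : |a| ≤ A) (h' : |b| ≤ B) : |a + b| ≤ A + B :=
  (abs_add_le a b).trans (add_le_add h h')

lemma asub {a b A B : ℝ} (h : |a| ≤ A) (h' : |b| ≤ B) : |a - b| ≤ A + B := by
  rw [sub_eq_add_neg]; exact aadd h (by rwa [abs_neg])

lemma remBound {C A : ℝ} : ∃ K, ∀ φ f X w w1 w2 σ σ1 y : ℝ, |φ| ≤ C → |f| ≤ C → |X| ≤ C →
    |w| ≤ C → |w1| ≤ C → |w2| ≤ C → |σ| ≤ A → |σ1| ≤ A → |y| ≤ 1 →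
    |2 * f * w * (0 - φ * w1 - X * (w * w) - 2 * φ * w * σ) - φ * w2 - 2 * X * w * w1
      - 2 * φ * w1 * σ - 2 * φ * w * σ1
      + 2 * σ * (0 - φ * w1 - X * (w * w) - 2 * φ * w * σ)
      + y * ((0 - φ * w1 - X * (w * w) - 2 * φ * w * σ) *
        (0 - φ * w1 - X * (w * w) - 2 * φ * w * σ))| ≤ K := by
  apply Exists.intro
  · intro φ f X w w1 w2 σ σ1 y hφ hf hX hw hw1 hw2 hσ hσ1 hy
    have h2 : |(2 : ℝ)| ≤ 2 := by simp
    have h0 : |(0 : ℝ)| ≤ 0 := by simp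
    have hq := asub (asub (asub h0 (amul hφ hw1)) (amul hX (amul hw hw)))
      (amul (amul (amul h2 hφ) hw) hσ)
    exact aadd (aadd (asub (asub (asub (asub (amul (amul (amul h2 hf) hw) hq) (amul hφ hw2))
      (amul (amul (amul h2 hX) hw) hw1)) (amul (amul (amul h2 hφ) hw1) hσ))
      (amul (amul (amul h2 hφ) hw) hσ1)) (amul (amul h2 hσ) hq)) (amul hy (amul hq hq))

/-- The Riccati corrector. -/
def hcor (φ f X W W1 s : ℝ → ℝ) (x : ℝ) : ℝ :=
  f x * W x + s x - φ x * W1 x - X x * W x ^ 2 - 2 * (φ x * W x * s x)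

variable {V φ f f1 X W W1 W2 : ℝ → ℝ} {ψ C L : ℝ}

lemma HL.core (H : HL V φ f f1 X W W1 W2 ψ C L) (A : ℝ) : ∃ K, 0 ≤ K ∧
    ∀ s s1 : ℝ → ℝ, ∀ x, 1 ≤ x → HasDerivAt s (s1 x) x → |s x * x| ≤ A → |s1 x * x ^ 2| ≤ A →
    ∃ d, HasDerivAt (hcor φ f X W W1 s) d x ∧
      |d + hcor φ f X W W1 s x ^ 2 - V x - (s1 x + s x ^ 2 + ψ * W x ^ 2)| ≤ K / x ^ 3 := by
  obtain ⟨K, hK⟩ := remBound (C := C) (A := A)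
  refine ⟨|K|, abs_nonneg _, ?_⟩
  intro s s1 x hx hs hsA hs1A
  have hx0 : 0 < x := by linarith
  have hd := ((((H.df x).mul (H.dW x)).add hs).sub ((H.dφ x).mul (H.dW1 x))).sub
    ((H.dX x).mul ((H.dW x).pow 2)) |>.sub ((((H.dφ x).mul (H.dW x)).mul hs).const_mul 2)
  refine ⟨_, hd, ?_⟩
  have h := hK (φ x) (f x) (X x) (W x * x) (W1 x * x ^ 2) (W2 x * x ^ 3) (s x * x)
    (s1 x * x ^ 2) (x⁻¹) (H.bφ x) (H.bf x) (H.bX x) (H.bW x hx) (H.bW1 x hx) (H.bW2 x hx)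
    hsA hs1A (by rw [abs_of_pos (by positivity)]; exact inv_le_one_of_one_le₀ hx)
  rw [le_div_iff₀ (by positivity)]
  refine le_trans (le_of_eq ?_) (h.trans (le_abs_self K))
  rw [← abs_of_pos (show (0 : ℝ) < x ^ 3 by positivity), ← abs_mul]
  rw [abs_of_pos (show (0 : ℝ) < x ^ 3 by positivity)]
  congr 1
  rw [H.V_eq, hcor]
  simp only [Nat.cast_ofNat, Nat.add_one_sub_one, pow_one, Pi.mul_apply, Pi.pow_apply]
  field_simp
  ring

lemma HL.ev (H : HL V φ f f1 X W W1 W2 ψ C L) (K : ℝ) {ε : ℝ} (hε : 0 < ε) :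
    ∃ R, 1 ≤ R ∧ ∀ x, R ≤ x → |ψ * W x ^ 2 - ψ * L / x ^ 2| + K / x ^ 3 ≤ ε / x ^ 2 := by
  have h1 : Tendsto (fun x => |ψ * (x ^ 2 * W x ^ 2) - ψ * L| + K / x) atTop (𝓝 (0 + 0)) := by
    refine Tendsto.add ?_ (tendsto_const_nhds.div_atTop tendsto_id)
    have := ((H.lim.const_mul ψ).sub_const (ψ * L)).abs
    simpa using this
  rw [add_zero] at h1
  obtain ⟨R, hR⟩ := eventually_atTop.1 (h1.eventually (eventually_le_nhds hε))
  refine ⟨max R 1, le_max_right _ _, fun x hx => ?_⟩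
  have hx0 : 0 < x := lt_of_lt_of_le one_pos ((le_max_right _ _).trans hx)
  have h := hR x ((le_max_left _ _).trans hx)
  rw [le_div_iff₀ (by positivity), add_mul]
  refine le_trans (le_of_eq ?_) h
  congr 1
  · rw [← abs_of_pos (show (0 : ℝ) < x ^ 2 by positivity), ← abs_mul,
      abs_of_pos (show (0 : ℝ) < x ^ 2 by positivity)]
    congr 1
    field_simp
  · field_simp

lemma HL.good (H : HL V φ f f1 X W W1 W2 ψ C L) (A : ℝ) {ε : ℝ} (hε : 0 < ε) :
    ∃ R, 1 ≤ R ∧ ∀ E a b, R ≤ a → a ≤ b → ∀ s s1 : ℝ → ℝ,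
      (∀ x ∈ Icc a b, HasDerivAt s (s1 x) x ∧ |s x * x| ≤ A ∧ |s1 x * x ^ 2| ≤ A ∧
        s1 x + s x ^ 2 + (ψ * L + ε) / x ^ 2 ≤ -E) → NN V E a b {a, b} := by
  obtain ⟨K, hK0, hK⟩ := H.core A
  obtain ⟨R, hR1, hR⟩ := H.ev K hε
  refine ⟨R, hR1, fun E a b hRa hab s s1 hs => ?_⟩
  have h : ∀ x, ∃ d, x ∈ Icc a b → (HasDerivAt (hcor φ f X W W1 s) d x ∧
      |d + hcor φ f X W W1 s x ^ 2 - V x - (s1 x + s x ^ 2 + ψ * W x ^ 2)| ≤ K / x ^ 3) := by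
    intro x
    by_cases hx : x ∈ Icc a b
    · obtain ⟨h1, h2, h3, -⟩ := hs x hx
      obtain ⟨d, hd⟩ := hK s s1 x (hR1.trans (hRa.trans hx.1)) h1 h2 h3
      exact ⟨d, fun _ => hd⟩
    · exact ⟨0, fun h => absurd h hx⟩
  choose d hd using h
  refine NN.riccati H.Vc hab (hcor φ f X W W1 s) d (fun x hx => (hd x hx).1) (fun x hx => ?_)
  have h1 := (abs_le.1 (hd x hx).2).2
  have h2 := hR x (hRa.trans hx.1)
  have h3 := (hs x hx).2.2.2
  have h4 := le_abs_self (ψ * W x ^ 2 - ψ * L / x ^ 2)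
  rw [add_div] at h3
  linarith

/-- Subcritical half line. -/
lemma HL.sub (H : HL V φ f f1 X W W1 W2 ψ C L) (hL : ψ * L < 1 / 4) :
    ∃ R, 1 ≤ R ∧ ∀ E ≤ 0, ∀ b ≥ R, NN V E R b {R, b} := by
  obtain ⟨R, hR1, hR⟩ := H.good 1 (ε := 1 / 4 - ψ * L) (by linarith)
  refine ⟨R, hR1, fun E hE b hb => hR E R b le_rfl hb (fun x => (1 / 2) * x⁻¹)
    (fun x => (1 / 2) * (-(x ^ 2)⁻¹)) fun x hx => ?_⟩
  have hx0 : 0 < x := by linarith [hx.1]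
  refine ⟨(hasDerivAt_inv hx0.ne').const_mul _, ?_, ?_, ?_⟩
  · rw [mul_assoc, inv_mul_cancel₀ hx0.ne']; norm_num [abs_le]
  · rw [show 1 / 2 * -(x ^ 2)⁻¹ * x ^ 2 = -(1 / 2) by field_simp]; norm_num [abs_le]
  · have : 1 / 2 * -(x ^ 2)⁻¹ + (1 / 2 * x⁻¹) ^ 2 + (ψ * L + (1 / 4 - ψ * L)) / x ^ 2 = 0 := by
      field_simp; ring
    linarith

set_option maxHeartbeats 1000000 in
/-- Supercritical half line: upper bound. -/
lemma HL.upper (H : HL V φ f f1 X W W1 W2 ψ C L) {T : ℝ} (hT : 0 < T)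
    (hTν : T * √(max (ψ * L - 1 / 4) 0) < π) :
    ∃ R, 1 ≤ R ∧ ∃ K : ℝ, ∀ E : ℝ, -1 < E → E < 0 → ∃ S : Finset ℝ,
      (S.card : ℝ) ≤ |log (|E|)| / (2 * T) + K ∧ ∃ B, ∀ b ≥ B, NN V E R b (insert b S) := by
  obtain ⟨ν, hν1, hν2⟩ := exists_between ((lt_div_iff₀' hT).2 hTν)
  have hν0 : 0 < ν := lt_of_le_of_lt (Real.sqrt_nonneg _) hν1
  rw [lt_div_iff₀' hT] at hν2
  have hνc : ψ * L < ν ^ 2 + 1 / 4 := by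
    have := (Real.sqrt_lt' hν0).1 hν1
    have := le_max_left (ψ * L - 1 / 4) 0
    linarith
  set τ : ℝ := tan (ν * T / 2) with hτ
  have hτ0 : 0 ≤ τ := tan_nonneg_of_nonneg_of_le_pi_div_two (by positivity) (by linarith)
  set A : ℝ := (1 / 2 + ν * τ) + ((1 / 2 + ν * τ) ^ 2 + (ν ^ 2 + 1 / 4)) with hA
  set ε : ℝ := ν ^ 2 + 1 / 4 - ψ * L with hε
  obtain ⟨R, hR1, hR⟩ := H.good A (ε := ε) (by linarith)
  have hR0 : 0 < R := by linarith
  set m : ℝ := ν + 1 with hm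
  refine ⟨R, hR1, (|log m| + |log R|) / T + 3, fun E hE1 hE => ?_⟩
  set t : ℕ := ⌈(log m - log R - log (|E|) / 2) / T⌉₊ with ht
  have hEabs : |E| = -E := abs_of_neg hE
  have hlogE : log (|E|) ≤ 0 := Real.log_nonpos (abs_nonneg _) (by rw [hEabs]; linarith)
  have htle : (t : ℝ) ≤ |log (|E|)| / (2 * T) + (|log m| + |log R|) / T + 1 := by
    have h1 : (t : ℝ) ≤ |(log m - log R - log (|E|) / 2) / T| + 1 := by
      refine le_trans ?_ (Nat.ceil_lt_add_one (abs_nonneg _)).le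
      exact_mod_cast Nat.ceil_mono (le_abs_self _)
    have h2 : |(log m - log R - log (|E|) / 2) / T| ≤
        |log (|E|)| / (2 * T) + (|log m| + |log R|) / T := by
      rw [abs_div, abs_of_pos hT, show |log (|E|)| / (2 * T) = (|log (|E|)| / 2) / T by
        field_simp, ← add_div]
      gcongr
      have := asub (asub (le_refl |log m|) (le_refl |log R|)) (le_refl |log (|E|) / 2|)
      rw [abs_div, abs_two] at this
      linarith
    linarith
  let x : ℕ → ℝ := fun k => R * exp (k * T)
  have hx0 : x 0 = R := by simp [x]
  have hxR : ∀ k, R ≤ x k := fun k =>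
    le_mul_of_one_le_right hR0.le (Real.one_le_exp (by positivity))
  refine ⟨(Finset.range (t + 1)).image x, ?_, x t, fun b hb => ?_⟩
  · have h1 : (((Finset.range (t + 1)).image x).card : ℝ) ≤ t + 1 := by
      exact_mod_cast Finset.card_image_le.trans (by simp)
    linarith
  have hA0 : 0 ≤ A := by positivity
  have k1 : NN V E (x 0) (x t) ((Finset.range (t + 1)).image x) := by
    refine NN.chain H.Vc x t (fun k _ => ?_)
    have hlogx : log (x k) = log R + k * T := by
      rw [Real.log_mul hR0.ne' (exp_pos _).ne', Real.log_exp]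
    have hlogx1 : log (x (k + 1)) = log R + k * T + T := by
      rw [Real.log_mul hR0.ne' (exp_pos _).ne', Real.log_exp]; push_cast; ring
    set c : ℝ := log R + k * T + T / 2 with hc
    have hxx : x k ≤ x (k + 1) := by
      simp only [x]; gcongr; linarith
    refine hR E (x k) (x (k + 1)) (hxR k) hxx
      (fun y => (1 / 2 - ν * tan (ν * (log y - c))) / y)
      (fun y => -((1 / 2 - ν * tan (ν * (log y - c))) / y) ^ 2 - (ν ^ 2 + 1 / 4) / y ^ 2)
      fun y hy => ?_
    have hy0 : 0 < y := hR0.trans_le ((hxR k).trans hy.1)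
    have hl1 : log (x k) ≤ log y := Real.log_le_log (hR0.trans_le (hxR k)) hy.1
    have hl2 : log y ≤ log (x (k + 1)) := Real.log_le_log hy0 hy.2
    rw [hlogx] at hl1
    rw [hlogx1] at hl2
    have hb1 : -(ν * T / 2) ≤ ν * (log y - c) := by
      have : -(T / 2) ≤ log y - c := by linarith
      nlinarith
    have hb2 : ν * (log y - c) ≤ ν * T / 2 := by
      have : log y - c ≤ T / 2 := by linarith
      nlinarith
    have hcos : 0 < cos (ν * (log y - c)) :=
      cos_pos_of_mem_Ioo ⟨by linarith, by linarith⟩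
    have hνT : 0 < ν * T := by positivity
    have hpi := pi_pos
    have htan : |tan (ν * (log y - c))| ≤ τ := by
      have hmono := Real.strictMonoOn_tan.monotoneOn
      have m1 : ν * T / 2 ∈ Ioo (-(π / 2)) (π / 2) := ⟨by linarith, by linarith⟩
      have m2 : -(ν * T / 2) ∈ Ioo (-(π / 2)) (π / 2) := ⟨by linarith, by linarith⟩
      have m3 : ν * (log y - c) ∈ Ioo (-(π / 2)) (π / 2) := ⟨by linarith, by linarith⟩
      rw [abs_le, hτ, ← Real.tan_neg]
      exact ⟨hmono m2 m3 hb1, hmono m3 m1 hb2⟩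
    have hσ : |1 / 2 - ν * tan (ν * (log y - c))| ≤ 1 / 2 + ν * τ := by
      refine asub (by norm_num [abs_le]) (amul ?_ htan)
      rw [abs_of_pos hν0]
    refine ⟨?_, ?_, ?_, ?_⟩
    · have h1 : HasDerivAt (fun y => ν * (log y - c)) (ν * y⁻¹) y :=
        ((Real.hasDerivAt_log hy0.ne').sub_const c).const_mul ν
      have h2 := ((((Real.hasDerivAt_tan hcos.ne').comp y h1).const_mul ν).const_sub
        (1 / 2)).div (hasDerivAt_id y) hy0.ne'
      refine h2.congr_deriv ?_
      simp only [Function.comp, id]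
      rw [tan_eq_sin_div_cos]
      have hcne := hcos.ne'
      set cc := cos (ν * (log y - c)) with hcc
      set ss := sin (ν * (log y - c)) with hss
      have hsc : ss ^ 2 + cc ^ 2 = 1 := sin_sq_add_cos_sq _
      field_simp
      linear_combination (16 * ν ^ 2) * hsc
    · rw [div_mul_cancel₀ _ hy0.ne']
      refine hσ.trans ?_
      rw [hA]
      have : 0 ≤ (1 / 2 + ν * τ) ^ 2 + (ν ^ 2 + 1 / 4) := by positivity
      linarith
    · have e : (-((1 / 2 - ν * tan (ν * (log y - c))) / y) ^ 2 - (ν ^ 2 + 1 / 4) / y ^ 2) * y ^ 2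
          = -((1 / 2 - ν * tan (ν * (log y - c))) ^ 2) - (ν ^ 2 + 1 / 4) := by
        field_simp
      rw [e]
      have h1 : |-((1 / 2 - ν * tan (ν * (log y - c))) ^ 2)| ≤ (1 / 2 + ν * τ) ^ 2 := by
        rw [abs_neg, sq, sq]; exact amul hσ hσ
      have h2 : |ν ^ 2 + 1 / 4| ≤ ν ^ 2 + 1 / 4 := by rw [abs_of_pos (by positivity)]
      refine (asub h1 h2).trans ?_
      have : 0 ≤ 1 / 2 + ν * τ := by positivity
      linarith
    · have : ψ * L + ε = ν ^ 2 + 1 / 4 := by rw [hε]; ring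
      rw [this]
      have e : (-((1 / 2 - ν * tan (ν * (log y - c))) / y) ^ 2 - (ν ^ 2 + 1 / 4) / y ^ 2) +
        ((1 / 2 - ν * tan (ν * (log y - c))) / y) ^ 2 + (ν ^ 2 + 1 / 4) / y ^ 2 = 0 := by ring
      linarith
  have k2 : NN V E (x t) b {x t, b} := by
    refine hR E (x t) b (hxR t) hb (fun _ => 0) (fun _ => 0) fun y hy => ?_
    refine ⟨hasDerivAt_const _ _, by simpa using hA0, by simpa using hA0, ?_⟩
    have hy0 : 0 < y := hR0.trans_le ((hxR t).trans hy.1)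
    have hε' : ψ * L + ε = ν ^ 2 + 1 / 4 := by rw [hε]; ring
    rw [hε']
    have hm0 : 0 < m := by positivity
    have hEpos : 0 < |E| := abs_pos.2 hE.ne
    -- y ≥ m / sqrt |E|
    have h1 : (log m - log R - log (|E|) / 2) / T ≤ t := Nat.le_ceil _
    rw [div_le_iff₀ hT] at h1
    have h2 : log (x t) = log R + t * T := by
      rw [Real.log_mul hR0.ne' (exp_pos _).ne', Real.log_exp]
    have h3 : log (x t) ≤ log y := Real.log_le_log (hR0.trans_le (hxR t)) hy.1
    have h4 : log (m ^ 2) ≤ log (|E| * y ^ 2) := by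
      rw [Real.log_mul hEpos.ne' (by positivity), Real.log_pow, Real.log_pow]
      push_cast
      linarith
    have h5 : m ^ 2 ≤ |E| * y ^ 2 := (Real.log_le_log_iff (by positivity) (by positivity)).1 h4
    have h6 : (ν ^ 2 + 1 / 4) / y ^ 2 ≤ -E := by
      rw [div_le_iff₀ (by positivity), ← hEabs]
      refine le_trans ?_ h5
      rw [hm]; nlinarith
    simpa using h6
  rw [hx0] at k1
  refine (k1.trans H.Vc k2).mono ?_
  intro z hz
  simp only [Finset.mem_union, Finset.mem_insert, Finset.mem_singleton] at hz ⊢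
  rcases hz with hz | rfl | rfl
  · exact Or.inr hz
  · exact Or.inr (Finset.mem_image.2 ⟨t, by simp, rfl⟩)
  · exact Or.inl rfl

/-! ### Trial functions -/

lemma mollify {V u u1 : ℝ → ℝ} (hV : Continuous V) {a b a' b' E : ℝ} (haa : a' < a)
    (hab : a ≤ b) (hbb : b < b') (hd : ∀ x, HasDerivAt u (u1 x) x) (hc : Continuous u1)
    (h0 : ∀ x, x ∉ Icc a b → u x = 0)
    (hneg : ∫ x in a'..b', (u1 x ^ 2 + (V x - E) * u x ^ 2) < 0) :
    ∃ U : ℝ → ℝ, ContDiff ℝ (⊤ : ℕ∞) U ∧ HasCompactSupport U ∧ tsupport U ⊆ Icc a' b' ∧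
      (∫ x, (deriv U x ^ 2 + V x * U x ^ 2)) < E * ∫ x, U x ^ 2 := by
  have hdu : deriv u = u1 := funext fun x => (hd x).deriv
  have huC : ContDiff ℝ 1 u := by
    rw [contDiff_one_iff_deriv]
    exact ⟨fun x => (hd x).differentiableAt, by rwa [hdu]⟩
  have hucont : Continuous u := huC.continuous
  have hucs : HasCompactSupport u := HasCompactSupport.intro isCompact_Icc h0
  have hu1cs : HasCompactSupport u1 := hdu ▸ hucs.deriv
  obtain ⟨M, hM⟩ := hucs.exists_bound_of_continuous hucont
  obtain ⟨M1, hM1⟩ := hu1cs.exists_bound_of_continuous hc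
  set δ : ℝ := min (a - a') (b' - b) with hδ
  have hδ0 : 0 < δ := lt_min (by linarith) (by linarith)
  have hδ1 : δ ≤ a - a' := min_le_left _ _
  have hδ2 : δ ≤ b' - b := min_le_right _ _
  let B : ℕ → ContDiffBump (0 : ℝ) := fun n =>
    { rIn := δ / (n + 2) / 2
      rOut := δ / (n + 2)
      rIn_pos := by positivity
      rIn_lt_rOut := by
        have : 0 < δ / ((n : ℝ) + 2) := by positivity
        linarith }
  have hBr : ∀ n, (B n).rOut ≤ δ := fun n => by
    show δ / ((n : ℝ) + 2) ≤ δ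
    exact div_le_self hδ0.le (by have : (0 : ℝ) ≤ n := by positivity
                                 linarith)
  have hBt : Tendsto (fun n => (B n).rOut) atTop (𝓝 0) := by
    show Tendsto (fun n : ℕ => δ / ((n : ℝ) + 2)) atTop (𝓝 0)
    exact tendsto_const_nhds.div_atTop
      (tendsto_atTop_add_const_right _ _ tendsto_natCast_atTop_atTop)
  let U : ℕ → ℝ → ℝ := fun n =>
    convolution ((B n).normed volume) u (ContinuousLinearMap.lsmul ℝ ℝ) volume
  let U1 : ℕ → ℝ → ℝ := fun n =>
    convolution ((B n).normed volume) u1 (ContinuousLinearMap.lsmul ℝ ℝ) volume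
  have hUs : ∀ n, ContDiff ℝ (⊤ : ℕ∞) (U n) := fun n =>
    HasCompactSupport.contDiff_convolution_left _ (B n).hasCompactSupport_normed
      (B n).contDiff_normed hucont.locallyIntegrable
  have hUd : ∀ n x, HasDerivAt (U n) (U1 n x) x := fun n x => by
    have := HasCompactSupport.hasDerivAt_convolution_right (ContinuousLinearMap.lsmul ℝ ℝ)
      (μ := volume) (f₀ := (B n).normed volume)
      ((B n).continuous_normed.locallyIntegrable) hucs huC x
    rwa [hdu] at this
  have hUd' : ∀ n, deriv (U n) = U1 n := fun n => funext fun x => (hUd n x).deriv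
  have hUsupp : ∀ n, tsupport (U n) ⊆ Icc a' b' := by
    intro n
    refine closure_minimal ?_ isClosed_Icc
    refine (support_convolution_subset _).trans ?_
    rw [(B n).support_normed_eq]
    rintro _ ⟨y, hy, z, hz, rfl⟩
    have hz' : z ∈ Icc a b := by
      by_contra h
      exact hz (h0 z h)
    have hy' : |y| < δ := by
      have : |y| < (B n).rOut := by simpa using hy
      exact this.trans_le (hBr n)
    have := abs_lt.1 hy'
    obtain ⟨z1, z2⟩ := hz'
    constructor <;> simp only <;> linarith
  have hUcs : ∀ n, HasCompactSupport (U n) := fun n =>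
    isCompact_Icc.of_isClosed_subset (isClosed_tsupport _) (hUsupp n)
  have hUb : ∀ n x, |U n x| ≤ 3 * M := by
    intro n x
    have := ContDiffBump.dist_normed_convolution_le (φ := B n) (μ := volume) (x₀ := x)
      (ε := 2 * M) hucont.aestronglyMeasurable (fun y _ => by
        rw [Real.dist_eq]
        have := asub (show |u y| ≤ M from hM y) (show |u x| ≤ M from hM x)
        linarith)
    rw [Real.dist_eq] at this
    have h2 := aadd this (show |u x| ≤ M from hM x)
    rw [sub_add_cancel] at h2
    exact h2.trans (by linarith)
  have hU1b : ∀ n x, |U1 n x| ≤ 3 * M1 := by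
    intro n x
    have := ContDiffBump.dist_normed_convolution_le (φ := B n) (μ := volume) (x₀ := x)
      (ε := 2 * M1) hc.aestronglyMeasurable (fun y _ => by
        rw [Real.dist_eq]
        have := asub (show |u1 y| ≤ M1 from hM1 y) (show |u1 x| ≤ M1 from hM1 x)
        linarith)
    rw [Real.dist_eq] at this
    have h2 := aadd this (show |u1 x| ≤ M1 from hM1 x)
    rw [sub_add_cancel] at h2
    exact h2.trans (by linarith)
  have hU1c : ∀ n, Continuous (U1 n) := fun n => by
    rw [← hUd' n]
    exact (hUs n).continuous_deriv (by exact_mod_cast le_top)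
  have hlim : Tendsto (fun n => ∫ x in a'..b', (U1 n x ^ 2 + (V x - E) * U n x ^ 2)) atTop
      (𝓝 (∫ x in a'..b', (u1 x ^ 2 + (V x - E) * u x ^ 2))) := by
    refine intervalIntegral.tendsto_integral_filter_of_dominated_convergence
      (fun x => 3 * M1 * (3 * M1) + |V x - E| * (3 * M * (3 * M))) ?_ ?_ ?_ ?_
    · refine Eventually.of_forall fun n => Continuous.aestronglyMeasurable ?_
      have := hU1c n
      have := (hUs n).continuous
      fun_prop
    · refine Eventually.of_forall fun n => Eventually.of_forall fun x _ => ?_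
      rw [Real.norm_eq_abs, sq, sq]
      exact aadd (amul (hU1b n x) (hU1b n x)) (amul le_rfl (amul (hUb n x) (hUb n x)))
    · apply Continuous.intervalIntegrable
      fun_prop
    · refine Eventually.of_forall fun x _ => ?_
      have t1 : Tendsto (fun n => U n x) atTop (𝓝 (u x)) :=
        ContDiffBump.convolution_tendsto_right_of_continuous hBt hucont x
      have t2 : Tendsto (fun n => U1 n x) atTop (𝓝 (u1 x)) :=
        ContDiffBump.convolution_tendsto_right_of_continuous hBt hc x
      exact (t2.pow 2).add ((t1.pow 2).const_mul _)
  -- enlarge a bit to handle the half-open interval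
  obtain ⟨n, hn⟩ := (hlim.eventually (eventually_lt_nhds hneg)).exists
  refine ⟨U n, hUs n, hUcs n, hUsupp n, ?_⟩
  have e := form_split hV ((hUs n).of_le (by exact_mod_cast le_top)) (hUcs n) E
  rw [← sub_neg, ← e]
  rw [hUd' n]
  have e2 : ∫ x in a'..b', (U1 n x ^ 2 + (V x - E) * U n x ^ 2) =
      ∫ x, (U1 n x ^ 2 + (V x - E) * U n x ^ 2) := by
    rw [intervalIntegral.integral_of_le (by linarith), ← integral_Icc_eq_integral_Ioc]
    apply setIntegral_eq_integral_of_forall_compl_eq_zero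
    intro x hx
    have hx' : x ∉ tsupport (U n) := fun h => hx (hUsupp n h)
    have a1 : U n x = 0 := image_eq_zero_of_notMem_tsupport hx'
    have a2 : U1 n x = 0 := by
      rw [← hUd' n]
      by_contra hne
      exact hx' (support_deriv_subset hne)
    simp [a1, a2]
  rwa [← e2]

lemma le_schN1 {V : ℝ → ℝ} (hV : Continuous V) {E : ℝ} {ι : Type} [Fintype ι]
    (u : ι → ℝ → ℝ) (hs : ∀ i, ContDiff ℝ (⊤ : ℕ∞) (u i)) (hc : ∀ i, HasCompactSupport (u i))
    (hdis : ∀ i j, i ≠ j → Disjoint (tsupport (u i)) (tsupport (u j)))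
    (hneg : ∀ i, (∫ x, (deriv (u i) x ^ 2 + V x * u i x ^ 2)) < E * ∫ x, u i x ^ 2) :
    (Fintype.card ι : ℕ∞) ≤ schN1 V E := by
  classical
  have hs1 : ∀ i, ContDiff ℝ 1 (u i) := fun i => (hs i).of_le (by exact_mod_cast le_top)
  have hvs : ∀ c : ι → ℝ, ContDiff ℝ (⊤ : ℕ∞) (∑ i, c i • u i) ∧
      HasCompactSupport (∑ i, c i • u i) := by
    intro c
    constructor
    · have : (∑ i, c i • u i) = fun x => ∑ i, c i * u i x := by
        ext x; simp
      rw [this]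
      exact ContDiff.sum fun i _ => contDiff_const.mul (hs i)
    · refine Finset.sum_induction _ HasCompactSupport (fun a b ha hb => ha.add hb)
        HasCompactSupport.zero (fun i _ => ?_)
      exact (hc i).smul_left (f := fun _ => c i)
  have hform : ∀ c : ι → ℝ,
      (∫ x, (deriv (∑ i, c i • u i) x ^ 2 + (V x - E) * (∑ i, c i • u i) x ^ 2)) =
      ∑ i, c i ^ 2 * ∫ x, (deriv (u i) x ^ 2 + (V x - E) * u i x ^ 2) := by
    intro c
    simp_rw [← integral_const_mul]
    rw [← integral_finsetSum]
    · congr 1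
      ext x
      have e1 : (∑ i, c i • u i) x = ∑ i, c i * u i x := by simp
      have e2 : deriv (∑ i, c i • u i) x = ∑ i, c i * deriv (u i) x := by
        rw [deriv_sum]
        · refine Finset.sum_congr rfl fun i _ => ?_
          exact deriv_const_smul (c i) ((hs1 i).differentiable one_ne_zero x)
        · intro i _
          exact ((hs1 i).differentiable one_ne_zero x).const_smul (c i)
      rw [e1, e2]
      have hz : ∀ i, x ∉ tsupport (u i) → u i x = 0 ∧ deriv (u i) x = 0 := fun i hx =>
        ⟨image_eq_zero_of_notMem_tsupport hx, by
          by_contra hne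
          exact hx (support_deriv_subset hne)⟩
      by_cases hx : ∃ j, x ∈ tsupport (u j)
      · obtain ⟨j, hj⟩ := hx
        have hz' : ∀ i, i ≠ j → u i x = 0 ∧ deriv (u i) x = 0 := fun i hij =>
          hz i fun h => (Set.disjoint_left.1 (hdis i j hij)) h hj
        rw [Finset.sum_eq_single j (fun i _ hij => by simp [(hz' i hij)]) (by simp),
          Finset.sum_eq_single j (fun i _ hij => by simp [(hz' i hij)]) (by simp),
          Finset.sum_eq_single j (fun i _ hij => by simp [(hz' i hij)]) (by simp)]
        ring
      · push Not at hx
        simp [fun i => hz i (hx i)]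
    · intro i _
      apply Integrable.const_mul
      apply Continuous.integrable_of_hasCompactSupport (form_cont hV (hs1 i) E)
      refine HasCompactSupport.add (f := fun x => deriv (u i) x ^ 2)
        (f' := fun x => (V x - E) * u i x ^ 2) ?_ ?_
      · exact (hc i).deriv.comp_left (g := fun y => y ^ 2) (by simp)
      · exact ((hc i).comp_left (g := fun y : ℝ => y ^ 2) (by simp)).mul_left
  have hneg' : ∀ i, ∫ x, (deriv (u i) x ^ 2 + (V x - E) * u i x ^ 2) < 0 := by
    intro i
    rw [form_split hV (hs1 i) (hc i) E]
    linarith [hneg i]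
  have hlt : ∀ c : ι → ℝ, c ≠ 0 →
      (∫ x, (deriv (∑ i, c i • u i) x ^ 2 + (V x - E) * (∑ i, c i • u i) x ^ 2)) < 0 := by
    intro c hc0
    rw [hform]
    obtain ⟨j, hj⟩ := Function.ne_iff.1 hc0
    refine Finset.sum_neg' (fun i _ => ?_) ⟨j, Finset.mem_univ _, ?_⟩
    · exact mul_nonpos_of_nonneg_of_nonpos (sq_nonneg _) (hneg' i).le
    · exact mul_neg_of_pos_of_neg (by simp only [Pi.zero_apply] at hj; positivity) (hneg' j)
  have hli : LinearIndependent ℝ u := by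
    rw [Fintype.linearIndependent_iff]
    intro c h0
    by_contra hcon
    push Not at hcon
    obtain ⟨i, hi⟩ := hcon
    have := hlt c (fun h => hi (congrFun h i))
    rw [h0] at this
    simp [deriv_zero] at this
  have hF := finrank_span_eq_card hli
  rw [← hF]
  refine le_iSup (fun F : {F : Submodule ℝ (ℝ → ℝ) //
      (∀ u ∈ F, ContDiff ℝ (⊤ : ℕ∞) u ∧ HasCompactSupport u) ∧
      (∀ u ∈ F, u ≠ 0 →
        (∫ x, (deriv u x ^ 2 + V x * u x ^ 2)) < E * ∫ x, u x ^ 2)} =>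
    (Module.finrank ℝ F.1 : ℕ∞)) ⟨Submodule.span ℝ (range u), ?_, ?_⟩
  · intro v hv
    obtain ⟨c, rfl⟩ := (Submodule.mem_span_range_iff_exists_fun ℝ).1 hv
    exact hvs c
  · intro v hv hv0
    obtain ⟨c, rfl⟩ := (Submodule.mem_span_range_iff_exists_fun ℝ).1 hv
    have := hlt c (fun h => hv0 (by simp [h]))
    rw [form_split hV ((hvs c).1.of_le (by exact_mod_cast le_top)) (hvs c).2 E] at this
    linarith

def Trial (V : ℝ → ℝ) (E : ℝ) (n : ℕ) : Prop :=
  ∃ u : Fin n → ℝ → ℝ, (∀ i, ContDiff ℝ (⊤ : ℕ∞) (u i)) ∧ (∀ i, HasCompactSupport (u i)) ∧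
    (∀ i j, i ≠ j → Disjoint (tsupport (u i)) (tsupport (u j))) ∧
    (∀ i, (∫ x, (deriv (u i) x ^ 2 + V x * u i x ^ 2)) < E * ∫ x, u i x ^ 2) ∧
    (∀ i, tsupport (u i) ⊆ Ioi 0)

lemma Trial.zero (V : ℝ → ℝ) (E : ℝ) : Trial V E 0 :=
  ⟨fun i => i.elim0, fun i => i.elim0, fun i => i.elim0, fun i => i.elim0, fun i => i.elim0,
    fun i => i.elim0⟩

lemma Trial.combine {V : ℝ → ℝ} (hV : Continuous V) {E : ℝ} {n m : ℕ} (h1 : Trial V E n)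
    (h2 : Trial (fun x => V (-x)) E m) : ((n + m : ℕ) : ℕ∞) ≤ schN1 V E := by
  obtain ⟨u, us, uc, ud, un, up⟩ := h1
  obtain ⟨v, vs, vc, vd, vn, vp⟩ := h2
  have ht : ∀ i, tsupport (fun x => v i (-x)) = (fun x => -x) ⁻¹' tsupport (v i) := fun i =>
    tsupport_comp_eq_preimage (v i) (Homeomorph.neg ℝ)
  have := le_schN1 hV (E := E) (ι := Fin n ⊕ Fin m)
    (Sum.elim u (fun i x => v i (-x))) ?_ ?_ ?_ ?_
  · simpa using this
  · rintro (i | i)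
    · exact us i
    · exact (vs i).comp contDiff_neg
  · rintro (i | i)
    · exact uc i
    · exact (vc i).comp_homeomorph (Homeomorph.neg ℝ)
  · have hx : ∀ i j, Disjoint (tsupport (u i)) (tsupport (fun x => v j (-x))) := by
      intro i j
      rw [ht, Set.disjoint_left]
      intro x hx hx'
      have a1 : 0 < x := up i hx
      have a2 : 0 < -x := vp j hx'
      linarith
    rintro (i | i) (j | j) hij
    · exact ud i j (fun h => hij (by rw [h]))
    · exact hx i j
    · exact (hx j i).symm
    · simp only [Sum.elim_inr]
      rw [ht, ht]
      exact (vd i j (fun h => hij (by rw [h]))).preimage _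
  · rintro (i | i)
    · exact un i
    · simp only [Sum.elim_inr]
      have e : ∀ x, deriv (fun x => v i (-x)) x = - deriv (v i) (-x) := fun x =>
        deriv_comp_neg (v i) x
      simp only [e, neg_sq]
      have := vn i
      rw [← integral_neg_eq_self, ← integral_neg_eq_self (fun x => v i (-x) ^ 2)]
      simpa using this

lemma glue {F F1 : ℝ → ℝ} {a b : ℝ} (hab : a < b) (hd : ∀ x ∈ Icc a b, HasDerivAt F (F1 x) x)
    (hc : ContinuousOn F1 (Icc a b)) (ha : F a = 0) (hb : F b = 0) (ha1 : F1 a = 0)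
    (hb1 : F1 b = 0) :
    (∀ x, HasDerivAt ((Icc a b).indicator F) ((Icc a b).indicator F1 x) x) ∧
      Continuous ((Icc a b).indicator F1) := by
  constructor
  · intro x
    rcases lt_trichotomy x a with h | h | h
    · have hx : x ∉ Icc a b := fun hx => absurd hx.1 (not_le.2 h)
      rw [Set.indicator_of_notMem hx]
      refine (hasDerivAt_const x (0 : ℝ)).congr_of_eventuallyEq ?_
      filter_upwards [Iio_mem_nhds h] with y hy
      exact Set.indicator_of_notMem (fun hx => absurd hx.1 (not_le.2 hy)) _
    · subst h
      have hx : x ∈ Icc x b := ⟨le_rfl, hab.le⟩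
      rw [Set.indicator_of_mem hx, ha1]
      have h1 : HasDerivWithinAt ((Icc x b).indicator F) 0 (Iic x) x := by
        refine (hasDerivWithinAt_const x (Iic x) (0 : ℝ)).congr (fun y hy => ?_) ?_
        · rcases (mem_Iic.1 hy).lt_or_eq with h | h
          · exact Set.indicator_of_notMem (fun hx => absurd hx.1 (not_le.2 h)) _
          · rw [h, Set.indicator_of_mem hx, ha]
        · rw [Set.indicator_of_mem hx, ha]
      have h2 : HasDerivWithinAt ((Icc x b).indicator F) 0 (Ici x) x := by
        have := (hd x hx).hasDerivWithinAt (s := Ici x)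
        rw [ha1] at this
        refine this.congr_of_eventuallyEq ?_ (Set.indicator_of_mem hx _)
        filter_upwards [self_mem_nhdsWithin, mem_nhdsWithin_of_mem_nhds (Iio_mem_nhds hab)]
          with y hy hy'
        exact Set.indicator_of_mem (show y ∈ Icc x b from ⟨hy, le_of_lt hy'⟩) _
      have := h1.union h2
      rwa [Iic_union_Ici, hasDerivWithinAt_univ] at this
    · rcases lt_trichotomy x b with h' | h' | h'
      · have hx : x ∈ Icc a b := ⟨h.le, h'.le⟩
        rw [Set.indicator_of_mem hx]
        refine (hd x hx).congr_of_eventuallyEq ?_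
        filter_upwards [Icc_mem_nhds h h'] with y hy
        exact Set.indicator_of_mem hy _
      · subst h'
        have hx : x ∈ Icc a x := ⟨hab.le, le_rfl⟩
        rw [Set.indicator_of_mem hx, hb1]
        have h1 : HasDerivWithinAt ((Icc a x).indicator F) 0 (Ici x) x := by
          refine (hasDerivWithinAt_const x (Ici x) (0 : ℝ)).congr (fun y hy => ?_) ?_
          · rcases (mem_Ici.1 hy).lt_or_eq with h | h
            · exact Set.indicator_of_notMem (fun hx => absurd hx.2 (not_le.2 h)) _
            · rw [← h, Set.indicator_of_mem hx, hb]
          · rw [Set.indicator_of_mem hx, hb]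
        have h2 : HasDerivWithinAt ((Icc a x).indicator F) 0 (Iic x) x := by
          have := (hd x hx).hasDerivWithinAt (s := Iic x)
          rw [hb1] at this
          refine this.congr_of_eventuallyEq ?_ (Set.indicator_of_mem hx _)
          filter_upwards [self_mem_nhdsWithin, mem_nhdsWithin_of_mem_nhds (Ioi_mem_nhds hab)]
            with y hy hy'
          exact Set.indicator_of_mem (show y ∈ Icc a x from ⟨le_of_lt hy', hy⟩) _
        have := h2.union h1
        rwa [Iic_union_Ici, hasDerivWithinAt_univ] at this
      · have hx : x ∉ Icc a b := fun hx => absurd hx.2 (not_le.2 h')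
        rw [Set.indicator_of_notMem hx]
        refine (hasDerivAt_const x (0 : ℝ)).congr_of_eventuallyEq ?_
        filter_upwards [Ioi_mem_nhds h'] with y hy
        exact Set.indicator_of_notMem (fun hx => absurd hx.2 (not_le.2 hy)) _
  · refine continuous_indicator ?_ (by rwa [isClosed_Icc.closure_eq])
    intro y hy
    rw [frontier_Icc hab.le] at hy
    rcases hy with rfl | rfl
    · exact ha1
    · exact hb1

lemma low_alg {ε D c P x g2 v v1 r Q e K : ℝ} (hε : 0 < ε) (hε1 : ε < 1) (hx : 0 < x)
    (hg1 : 1 - ε ≤ g2) (hg2 : g2 ≤ 1 + ε) (hr : r ^ 2 ≤ K ^ 2 / x ^ 4)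
    (hK : (1 + ε) * (1 + 1 / ε) * K ^ 2 / x ^ 2 ≤ ε)
    (hQ : Q ≤ -(P - ε) / x ^ 2) (he : e ≤ ε / x ^ 2) (hP : 0 ≤ P - 2 * ε)
    (hD : D = (1 + ε) ^ 2) (hc : c * D ≤ (1 - ε) * (P - 2 * ε) - ε) :
    g2 * (v1 + r * v) ^ 2 + (Q + e) * (g2 * v ^ 2) ≤ D * (v1 ^ 2 - c * v ^ 2 / x ^ 2) := by
  have hx2 : 0 < x ^ 2 := by positivity
  have h1 : (v1 + r * v) ^ 2 ≤ (1 + ε) * v1 ^ 2 + (1 + 1 / ε) * (r ^ 2 * v ^ 2) := by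
    have : (1 + ε) * v1 ^ 2 + (1 + 1 / ε) * (r ^ 2 * v ^ 2) - (v1 + r * v) ^ 2
      = (ε * v1 - r * v) ^ 2 / ε := by field_simp; ring
    have h2 : 0 ≤ (ε * v1 - r * v) ^ 2 / ε := by positivity
    linarith
  have h2 : g2 * (v1 + r * v) ^ 2 ≤
      (1 + ε) * ((1 + ε) * v1 ^ 2 + (1 + 1 / ε) * (r ^ 2 * v ^ 2)) :=
    mul_le_mul hg2 h1 (by positivity) (by linarith)
  have h3 : (1 + ε) * (1 + 1 / ε) * r ^ 2 ≤ ε / x ^ 2 := by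
    calc (1 + ε) * (1 + 1 / ε) * r ^ 2 ≤ (1 + ε) * (1 + 1 / ε) * (K ^ 2 / x ^ 4) := by gcongr
      _ = ((1 + ε) * (1 + 1 / ε) * K ^ 2 / x ^ 2) / x ^ 2 := by field_simp
      _ ≤ ε / x ^ 2 := by gcongr
  have h3' : (1 + ε) * (1 + 1 / ε) * r ^ 2 * v ^ 2 ≤ ε / x ^ 2 * v ^ 2 := by gcongr
  have h4 : (Q + e) ≤ -((P - 2 * ε) / x ^ 2) := by
    have : -(P - ε) / x ^ 2 + ε / x ^ 2 = -((P - 2 * ε) / x ^ 2) := by ring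
    linarith
  have h5 : (Q + e) * (g2 * v ^ 2) ≤ -((P - 2 * ε) / x ^ 2) * ((1 - ε) * v ^ 2) := by
    have a1 : (Q + e) * (g2 * v ^ 2) ≤ -((P - 2 * ε) / x ^ 2) * (g2 * v ^ 2) :=
      mul_le_mul_of_nonneg_right h4 (mul_nonneg (by linarith) (sq_nonneg _))
    have a2 : (1 - ε) * v ^ 2 ≤ g2 * v ^ 2 := by gcongr
    have a3 : 0 ≤ (P - 2 * ε) / x ^ 2 := by positivity
    nlinarith [mul_le_mul_of_nonneg_left a2 a3]
  have h6 : c * D * (v ^ 2 / x ^ 2) ≤ ((1 - ε) * (P - 2 * ε) - ε) * (v ^ 2 / x ^ 2) := by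
    gcongr
  have e1 : D * (v1 ^ 2 - c * v ^ 2 / x ^ 2) = D * v1 ^ 2 - c * D * (v ^ 2 / x ^ 2) := by ring
  have e2 : ((1 - ε) * (P - 2 * ε) - ε) * (v ^ 2 / x ^ 2) =
    (P - 2 * ε) / x ^ 2 * ((1 - ε) * v ^ 2) - ε / x ^ 2 * v ^ 2 := by ring
  rw [e1, hD] at *
  nlinarith

lemma HL.low (H : HL V φ f f1 X W W1 W2 ψ C L) {c : ℝ} (hc0 : 0 < c) (hc : c < ψ * L) :
    ∃ R, 1 ≤ R ∧ ∃ ε D, 0 < ε ∧ 0 < D ∧ ∀ x, R ≤ x → ∃ d,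
      HasDerivAt (hcor φ f X W W1 (fun _ => 0)) d x ∧
      ∀ E ≤ 0, |E| * x ^ 2 ≤ ε → ∀ v v1 : ℝ,
        (exp (φ x * W x) * (v1 + (f x * W x + φ x * W1 x) * v)) ^ 2 +
          (V x - E) * (exp (φ x * W x) * v) ^ 2 ≤
        d * (exp (φ x * W x) * v) ^ 2 +
          hcor φ f X W W1 (fun _ => 0) x * (2 * (exp (φ x * W x) * v) *
            (exp (φ x * W x) * (v1 + (f x * W x + φ x * W1 x) * v))) +
          D * (v1 ^ 2 - c * v ^ 2 / x ^ 2) := by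
  -- choose ε
  have hev : ∀ᶠ ε in 𝓝[>] (0 : ℝ), ε < 1 ∧ 0 < ψ * L - 2 * ε ∧
      0 < (1 - ε) * (ψ * L - 2 * ε) - ε - c * (1 + ε) ^ 2 := by
    have t1 : Tendsto (fun ε : ℝ => ψ * L - 2 * ε) (𝓝[>] 0) (𝓝 (ψ * L - 2 * 0)) :=
      (Continuous.tendsto (by fun_prop) _).mono_left nhdsWithin_le_nhds
    have t2 : Tendsto (fun ε : ℝ => (1 - ε) * (ψ * L - 2 * ε) - ε - c * (1 + ε) ^ 2) (𝓝[>] 0)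
        (𝓝 ((1 - 0) * (ψ * L - 2 * 0) - 0 - c * (1 + 0) ^ 2)) :=
      (Continuous.tendsto (f := fun ε : ℝ => (1 - ε) * (ψ * L - 2 * ε) - ε - c * (1 + ε) ^ 2)
        (by fun_prop) _).mono_left nhdsWithin_le_nhds
    have t3 : Tendsto (fun ε : ℝ => ε) (𝓝[>] 0) (𝓝 0) :=
      tendsto_id.mono_left nhdsWithin_le_nhds
    exact (t3.eventually (eventually_lt_nhds one_pos)).and
      ((t1.eventually (eventually_gt_nhds (by linarith))).and
        (t2.eventually (eventually_gt_nhds (by linarith))))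
  obtain ⟨ε, ⟨hε1, hε2, hε3⟩, hε0⟩ := (hev.and self_mem_nhdsWithin).exists
  have hε0 : 0 < ε := hε0
  obtain ⟨K, hK0, hK⟩ := H.core 0
  obtain ⟨R1, hR11, hR1⟩ := H.ev K hε0
  set K' : ℝ := 2 * C * C + C * (C * C) with hK'
  have tK : ∀ᶠ x : ℝ in atTop, (1 + ε) * (1 + 1 / ε) * K' ^ 2 / x ^ 2 ≤ ε := by
    have : Tendsto (fun x : ℝ => (1 + ε) * (1 + 1 / ε) * K' ^ 2 / x ^ 2) atTop (𝓝 0) :=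
      tendsto_const_nhds.div_atTop (tendsto_pow_atTop two_ne_zero)
    exact this.eventually (eventually_le_nhds hε0)
  have tg : Tendsto (fun x => exp (φ x * W x) ^ 2) atTop (𝓝 1) := by
    have h0 : Tendsto (fun x => φ x * W x) atTop (𝓝 0) := by
      refine squeeze_zero_norm' (a := fun x => C * C / x) ?_
        (tendsto_const_nhds.div_atTop tendsto_id)
      filter_upwards [eventually_ge_atTop 1] with x hx
      have hx0 : 0 < x := by linarith
      rw [Real.norm_eq_abs, le_div_iff₀ hx0, ← abs_of_pos hx0, ← abs_mul, abs_of_pos hx0,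
        mul_assoc]
      exact amul (H.bφ x) (H.bW x hx)
    have := ((Real.continuous_exp.tendsto 0).comp h0).pow 2
    simpa using this
  have tg1 := tg.eventually (eventually_ge_nhds (show 1 - ε < 1 by linarith))
  have tg2 := tg.eventually (eventually_le_nhds (show 1 < 1 + ε by linarith))
  obtain ⟨R2, hR2⟩ := eventually_atTop.1 (tK.and (tg1.and tg2))
  refine ⟨max R1 R2, hR11.trans (le_max_left _ _), ε, (1 + ε) ^ 2, hε0, by positivity,
    fun x hx => ?_⟩
  have hxR1 : R1 ≤ x := (le_max_left _ _).trans hx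
  have hx1 : 1 ≤ x := hR11.trans hxR1
  have hx0 : 0 < x := by linarith
  obtain ⟨k1, k2, k3⟩ := hR2 x ((le_max_right _ _).trans hx)
  obtain ⟨d, hd, hd'⟩ := hK (fun _ => 0) (fun _ => 0) x hx1 (hasDerivAt_const _ _) (by simp)
    (by simp)
  refine ⟨d, hd, fun E hE hEx v v1 => ?_⟩
  have hr : (2 * φ x * W1 x + X x * W x ^ 2) ^ 2 ≤ K' ^ 2 / x ^ 4 := by
    have h1 : |(2 * φ x * W1 x + X x * W x ^ 2) * x ^ 2| ≤ K' := by
      have h2 : |(2 : ℝ)| ≤ 2 := by simp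
      have := aadd (amul (amul h2 (H.bφ x)) (H.bW1 x hx1))
        (amul (H.bX x) (amul (H.bW x hx1) (H.bW x hx1)))
      convert this using 2
      ring
    rw [le_div_iff₀ (by positivity)]
    have h2 := sq_le_sq' (abs_le.1 h1).1 (abs_le.1 h1).2
    calc _ = ((2 * φ x * W1 x + X x * W x ^ 2) * x ^ 2) ^ 2 := by ring
      _ ≤ _ := h2
  have h1 := (abs_le.1 hd').1
  have h2 := hR1 x hxR1
  have h4 := neg_abs_le (ψ * W x ^ 2 - ψ * L / x ^ 2)
  have hQ : V x - d - hcor φ f X W W1 (fun _ => 0) x ^ 2 ≤ -(ψ * L - ε) / x ^ 2 := by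
    have : -(ψ * L - ε) / x ^ 2 = - (ψ * L / x ^ 2) + ε / x ^ 2 := by ring
    rw [this]
    linarith
  have he : -E ≤ ε / x ^ 2 := by
    rw [le_div_iff₀ (by positivity), ← abs_of_nonpos hE]; exact hEx
  have key := low_alg (c := c) (v := v) (v1 := v1) hε0 hε1 hx0 k2 k3 hr k1 hQ he hε2.le rfl (by linarith)
  have e : (exp (φ x * W x) * (v1 + (f x * W x + φ x * W1 x) * v)) ^ 2 +
          (V x - E) * (exp (φ x * W x) * v) ^ 2 -
        (d * (exp (φ x * W x) * v) ^ 2 +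
          hcor φ f X W W1 (fun _ => 0) x * (2 * (exp (φ x * W x) * v) *
            (exp (φ x * W x) * (v1 + (f x * W x + φ x * W1 x) * v)))) =
      exp (φ x * W x) ^ 2 * (v1 + (2 * φ x * W1 x + X x * W x ^ 2) * v) ^ 2 +
      (V x - d - hcor φ f X W W1 (fun _ => 0) x ^ 2 + -E) * (exp (φ x * W x) ^ 2 * v ^ 2) := by
    simp only [hcor]
    ring
  linarith

lemma HL.trial_one (H : HL V φ f f1 X W W1 W2 ψ C L) {ω p : ℝ} (hω : 0 < ω) (hp : 1 < p)
    (hc : 1 / 4 + ω ^ 2 * p ^ 2 / (2 * p - 1) < ψ * L) :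
    ∃ R, 1 ≤ R ∧ ∃ ε, 0 < ε ∧ ∀ E < 0, ∀ a, R ≤ a → |E| * (a * exp (π / ω)) ^ 2 ≤ ε →
      ∀ a' b', a' < a → a * exp (π / ω) < b' →
      ∃ U : ℝ → ℝ, ContDiff ℝ (⊤ : ℕ∞) U ∧ HasCompactSupport U ∧ tsupport U ⊆ Icc a' b' ∧
      (∫ x, (deriv U x ^ 2 + V x * U x ^ 2)) < E * ∫ x, U x ^ 2 := by
  have hp1 : 0 < 2 * p - 1 := by linarith
  set c : ℝ := 1 / 4 + ω ^ 2 * p ^ 2 / (2 * p - 1) with hcdef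
  obtain ⟨R, hR1, ε, D, hε, hD, hlow⟩ := H.low (c := c) (by positivity) hc
  refine ⟨R, hR1, ε / 2, by positivity, fun E hE a hRa hEa a' b' ha' hb' => ?_⟩
  have ha0 : 0 < a := by linarith
  set b : ℝ := a * exp (π / ω) with hb
  have hab : a < b := lt_mul_of_one_lt_right ha0 (Real.one_lt_exp_iff.2 (by positivity))
  set θ : ℝ → ℝ := fun x => ω * (log x - log a) with hθ
  have hθa : θ a = 0 := by simp [hθ]
  have hθb : θ b = π := by
    simp only [hθ, hb]
    rw [Real.log_mul ha0.ne' (exp_pos _).ne', Real.log_exp]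
    field_simp
    ring
  have hdθ : ∀ x, 0 < x → HasDerivAt θ (ω * x⁻¹) x := fun x hx =>
    ((Real.hasDerivAt_log hx.ne').sub_const _).const_mul ω
  have hθpos : ∀ x ∈ Ioo a b, 0 < sin (θ x) := by
    intro x hx
    have hx0 : 0 < x := ha0.trans hx.1
    apply sin_pos_of_pos_of_lt_pi
    · have := Real.log_lt_log ha0 hx.1
      exact mul_pos hω (by linarith)
    · rw [← hθb]
      have := Real.log_lt_log hx0 hx.2
      exact mul_lt_mul_of_pos_left (by linarith) hω
  have hds : ∀ x, 0 < x → HasDerivAt (fun x => sin (θ x)) (cos (θ x) * (ω * x⁻¹)) x :=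
    fun x hx => (hdθ x hx).sin
  have hdc : ∀ x, 0 < x → HasDerivAt (fun x => cos (θ x)) (-sin (θ x) * (ω * x⁻¹)) x :=
    fun x hx => (hdθ x hx).cos
  let v : ℝ → ℝ := fun x => √x * sin (θ x) ^ p
  let v1 : ℝ → ℝ := fun x => 1 / (2 * √x) * sin (θ x) ^ p +
    √x * (cos (θ x) * (ω * x⁻¹) * p * sin (θ x) ^ (p - 1))
  have hdv : ∀ x, 0 < x → HasDerivAt v (v1 x) x := fun x hx =>
    (Real.hasDerivAt_sqrt hx.ne').mul ((hds x hx).rpow_const (Or.inr hp.le))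
  let F : ℝ → ℝ := fun x => exp (φ x * W x) * v x
  let F1 : ℝ → ℝ := fun x => exp (φ x * W x) * (v1 x + (f x * W x + φ x * W1 x) * v x)
  have hdF : ∀ x, 0 < x → HasDerivAt F (F1 x) x := fun x hx => by
    refine ((((H.dφ x).mul (H.dW x)).exp).mul (hdv x hx)).congr_deriv ?_
    simp only [F1, Pi.mul_apply]
    ring
  have hxpos : ∀ x ∈ Icc a b, 0 < x := fun x hx => ha0.trans_le hx.1
  have hθcont : ContinuousOn θ (Icc a b) := fun x hx =>
    (hdθ x (hxpos x hx)).continuousAt.continuousWithinAt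
  have cφ : Continuous φ := continuous_iff_continuousAt.2 fun x => (H.dφ x).continuousAt
  have cf : Continuous f := continuous_iff_continuousAt.2 fun x => (H.df x).continuousAt
  have cW : Continuous W := continuous_iff_continuousAt.2 fun x => (H.dW x).continuousAt
  have cW1 : Continuous W1 := continuous_iff_continuousAt.2 fun x => (H.dW1 x).continuousAt
  have hvcont : ContinuousOn v (Icc a b) := fun x hx =>
    (hdv x (hxpos x hx)).continuousAt.continuousWithinAt
  have hFcont : ContinuousOn F (Icc a b) := fun x hx =>
    (hdF x (hxpos x hx)).continuousAt.continuousWithinAt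
  have hv1cont : ContinuousOn v1 (Icc a b) := by
    have c1 : ContinuousOn (fun x => sin (θ x) ^ p) (Icc a b) :=
      (Real.continuous_sin.comp_continuousOn hθcont).rpow_const
        (fun x _ => Or.inr (by linarith))
    have c2 : ContinuousOn (fun x => sin (θ x) ^ (p - 1)) (Icc a b) :=
      (Real.continuous_sin.comp_continuousOn hθcont).rpow_const
        (fun x _ => Or.inr (by linarith))
    have c3 : ContinuousOn (fun x => cos (θ x)) (Icc a b) :=
      Real.continuous_cos.comp_continuousOn hθcont
    have c4 : ContinuousOn (fun x : ℝ => x⁻¹) (Icc a b) :=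
      continuousOn_inv₀.mono fun x hx => (hxpos x hx).ne'
    have c5 : ContinuousOn (fun x : ℝ => √x) (Icc a b) := Real.continuous_sqrt.continuousOn
    have c6 : ContinuousOn (fun x : ℝ => 1 / (2 * √x)) (Icc a b) :=
      continuousOn_const.div (continuousOn_const.mul c5) fun x hx => by
        have := Real.sqrt_pos.2 (hxpos x hx)
        positivity
    exact (c6.mul c1).add (c5.mul (((c3.mul (continuousOn_const.mul c4)).mul
      continuousOn_const).mul c2))
  have hF1cont : ContinuousOn F1 (Icc a b) := by
    have c1 : Continuous (fun x => exp (φ x * W x)) := by fun_prop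
    have c2 : Continuous (fun x => f x * W x + φ x * W1 x) := by fun_prop
    exact c1.continuousOn.mul (hv1cont.add (c2.continuousOn.mul hvcont))
  have z1 : (0 : ℝ) ^ p = 0 := Real.zero_rpow (by linarith)
  have z2 : (0 : ℝ) ^ (p - 1) = 0 := Real.zero_rpow (by linarith)
  have z3 : (0 : ℝ) ^ (2 * p - 1) = 0 := Real.zero_rpow (by linarith)
  have va : v a = 0 := by simp [v, hθa, z1]
  have vb : v b = 0 := by simp [v, hθb, z1]
  have v1a : v1 a = 0 := by simp [v1, hθa, z1, z2]
  have v1b : v1 b = 0 := by simp [v1, hθb, z1, z2]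
  have Fa : F a = 0 := by simp [F, va]
  have Fb : F b = 0 := by simp [F, vb]
  have F1a : F1 a = 0 := by simp [F1, va, v1a]
  have F1b : F1 b = 0 := by simp [F1, vb, v1b]
  obtain ⟨g1, g2⟩ := glue hab (fun x hx => hdF x (hxpos x hx)) hF1cont Fa Fb F1a F1b
  refine mollify H.Vc ha' hab.le hb' g1 g2 (fun x hx => Set.indicator_of_notMem hx _) ?_
  -- the antiderivative
  set κ : ℝ := ω * p ^ 2 / (2 * p - 1) with hκ
  let G : ℝ → ℝ := fun x => (sin (θ x) ^ p) ^ 2 / 2 + κ * (sin (θ x) ^ (2 * p - 1) * cos (θ x))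
  have hdG : ∀ x ∈ Icc a b, ∃ d, HasDerivAt G d x ∧
      (x ∈ Ioo a b → d = v1 x ^ 2 - c * v x ^ 2 / x ^ 2) := by
    intro x hx
    have hx0 := hxpos x hx
    have h1 := (hds x hx0).rpow_const (p := p) (Or.inr hp.le)
    have h2 := (hds x hx0).rpow_const (p := 2 * p - 1) (Or.inr (by linarith))
    refine ⟨_, ((h1.pow 2).div_const 2).add ((h2.mul (hdc x hx0)).const_mul κ), fun hxo => ?_⟩
    have hs := hθpos x hxo
    have e1 : sin (θ x) ^ p = sin (θ x) * sin (θ x) ^ (p - 1) := by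
      rw [← Real.rpow_one_add' hs.le (by linarith)]; congr 1; ring
    have e2 : sin (θ x) ^ (2 * p - 1) = sin (θ x) * (sin (θ x) ^ (p - 1) * sin (θ x) ^ (p - 1)) := by
      rw [← Real.rpow_add hs, ← Real.rpow_one_add' hs.le (by linarith)]; congr 1; ring
    have e3 : sin (θ x) ^ (2 * p - 1 - 1) = sin (θ x) ^ (p - 1) * sin (θ x) ^ (p - 1) := by
      rw [← Real.rpow_add hs]; congr 1; ring
    simp only [v, v1]
    rw [e3, e2, e1]
    set S := sin (θ x)
    set Y := S ^ (p - 1)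
    set Z := cos (θ x)
    have hq : x = √x ^ 2 := (Real.sq_sqrt hx0.le).symm
    have hq0 : 0 < √x := Real.sqrt_pos.2 hx0
    set q := √x
    rw [hκ, hcdef]
    simp only [Nat.cast_ofNat, Nat.add_one_sub_one, pow_one]
    rw [hq]
    have hp1' := hp1.ne'
    field_simp
    ring
  have hdG' : ∀ x, ∃ d, x ∈ Icc a b → HasDerivAt G d x ∧
      (x ∈ Ioo a b → d = v1 x ^ 2 - c * v x ^ 2 / x ^ 2) := by
    intro x
    by_cases hx : x ∈ Icc a b
    · obtain ⟨d, hd⟩ := hdG x hx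
      exact ⟨d, fun _ => hd⟩
    · exact ⟨0, fun h => absurd h hx⟩
  choose G1 hG1 using hdG'
  have hlow' : ∀ x, ∃ d, R ≤ x → (HasDerivAt (hcor φ f X W W1 (fun _ => 0)) d x ∧
      ∀ E ≤ 0, |E| * x ^ 2 ≤ ε → ∀ v v1 : ℝ,
        (exp (φ x * W x) * (v1 + (f x * W x + φ x * W1 x) * v)) ^ 2 +
          (V x - E) * (exp (φ x * W x) * v) ^ 2 ≤
        d * (exp (φ x * W x) * v) ^ 2 +
          hcor φ f X W W1 (fun _ => 0) x * (2 * (exp (φ x * W x) * v) *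
            (exp (φ x * W x) * (v1 + (f x * W x + φ x * W1 x) * v))) +
          D * (v1 ^ 2 - c * v ^ 2 / x ^ 2)) := by
    intro x
    by_cases hx : R ≤ x
    · obtain ⟨d, hd⟩ := hlow x hx
      exact ⟨d, fun _ => hd⟩
    · exact ⟨0, fun h => absurd h hx⟩
  choose d hd using hlow'
  have hΦ : ∀ x ∈ Icc a b, HasDerivAt
      (fun x => hcor φ f X W W1 (fun _ => 0) x * F x ^ 2 + D * G x)
      (d x * F x ^ 2 + hcor φ f X W W1 (fun _ => 0) x * (2 * F x * F1 x) + D * G1 x) x := by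
    intro x hx
    refine (((hd x (hRa.trans hx.1)).1.mul ((hdF x (hxpos x hx)).pow 2)).add
      ((hG1 x hx).1.const_mul D)).congr_deriv ?_
    simp
  have hcont : ContinuousOn (fun x => F1 x ^ 2 + (V x - 2 * E) * F x ^ 2) (Icc a b) :=
    (hF1cont.pow 2).add ((H.Vc.sub continuous_const).continuousOn.mul (hFcont.pow 2))
  have main := intervalIntegral.integral_le_sub_of_hasDeriv_right_of_le hab.le
    (g := fun x => hcor φ f X W W1 (fun _ => 0) x * F x ^ 2 + D * G x)
    (g' := fun x => d x * F x ^ 2 + hcor φ f X W W1 (fun _ => 0) x * (2 * F x * F1 x) + D * G1 x)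
    (φ := fun x => F1 x ^ 2 + (V x - 2 * E) * F x ^ 2)
    (fun x hx => (hΦ x hx).continuousAt.continuousWithinAt)
    (fun x hx => (hΦ x (Ioo_subset_Icc_self hx)).hasDerivWithinAt)
    hcont.integrableOn_Icc
    (fun x hx => by
      have hxI := Ioo_subset_Icc_self hx
      rw [(hG1 x hxI).2 hx]
      refine (hd x (hRa.trans hx.1.le)).2 (2 * E) (by linarith) ?_ (v x) (v1 x)
      rw [abs_mul, abs_two]
      have : x ^ 2 ≤ b ^ 2 := pow_le_pow_left₀ (hxpos x hxI).le hx.2.le 2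
      have := mul_le_mul_of_nonneg_left this (abs_nonneg E)
      linarith)
  have Ga : G a = 0 := by simp [G, hθa, z1, z3]
  have Gb : G b = 0 := by simp [G, hθb, z1, z3]
  simp only [Fa, Fb, Ga, Gb] at main
  have hFint : IntervalIntegrable (fun x => F x ^ 2) volume a b :=
    ContinuousOn.intervalIntegrable_of_Icc hab.le (hFcont.pow 2)
  have hF1int : IntervalIntegrable (fun x => F1 x ^ 2 + (V x - 2 * E) * F x ^ 2) volume a b :=
    ContinuousOn.intervalIntegrable_of_Icc hab.le hcont
  have hpos : 0 < ∫ x in a..b, F x ^ 2 := by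
    refine intervalIntegral.intervalIntegral_pos_of_pos_on hFint (fun x hx => ?_) hab
    have := hθpos x hx
    have hx0 : 0 < x := ha0.trans hx.1
    have : 0 < F x := mul_pos (exp_pos _)
      (mul_pos (Real.sqrt_pos.2 hx0) (Real.rpow_pos_of_pos this _))
    positivity
  have e1 : ∫ x in a'..b', ((Icc a b).indicator F1 x ^ 2 +
      (V x - E) * (Icc a b).indicator F x ^ 2) =
      ∫ x in a..b, (F1 x ^ 2 + (V x - E) * F x ^ 2) := by
    rw [intervalIntegral.integral_of_le (by linarith), intervalIntegral.integral_of_le hab.le,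
      ← integral_Icc_eq_integral_Ioc, ← integral_Icc_eq_integral_Ioc]
    have : (fun x => (Icc a b).indicator F1 x ^ 2 +
      (V x - E) * (Icc a b).indicator F x ^ 2) =
      (Icc a b).indicator (fun x => F1 x ^ 2 + (V x - E) * F x ^ 2) := by
      ext x
      by_cases hx : x ∈ Icc a b <;> simp only [Set.indicator_of_mem, Set.indicator_of_notMem, hx,
        not_false_eq_true] <;> simp
    rw [this, setIntegral_indicator measurableSet_Icc,
      Set.inter_eq_right.2 (Icc_subset_Icc ha'.le hb'.le)]
  rw [e1]
  have e2 : ∫ x in a..b, (F1 x ^ 2 + (V x - E) * F x ^ 2) =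
      (∫ x in a..b, (F1 x ^ 2 + (V x - 2 * E) * F x ^ 2)) + E * ∫ x in a..b, F x ^ 2 := by
    rw [← intervalIntegral.integral_const_mul, ← intervalIntegral.integral_add hF1int
      (hFint.const_mul E)]
    congr 1
    ext x; ring
  rw [e2]
  have := mul_neg_of_neg_of_pos hE hpos
  simp at main
  linarith

lemma HL.lower (H : HL V φ f f1 X W W1 W2 ψ C L) {T : ℝ} (hT : 0 < T)
    (hTν : π < T * √(max (ψ * L - 1 / 4) 0)) :
    ∃ K : ℝ, ∀ E : ℝ, -1 < E → E < 0 → ∃ n : ℕ,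
      |log (|E|)| / (2 * T) - K ≤ n ∧ Trial V E n := by
  obtain ⟨ω, hω1, hω2⟩ := exists_between ((div_lt_iff₀' hT).2 hTν)
  have hω0 : 0 < ω := lt_trans (by positivity) hω1
  have hωT : π / ω < T := by
    rw [div_lt_iff₀ hT] at hω1
    rw [div_lt_iff₀ hω0]; linarith
  have hωc : 1 / 4 + ω ^ 2 < ψ * L := by
    have h1 := (Real.lt_sqrt hω0.le).1 hω2
    rcases lt_max_iff.1 h1 with h | h
    · linarith
    · nlinarith
  obtain ⟨p, hp, hpc⟩ : ∃ p : ℝ, 1 < p ∧ 1 / 4 + ω ^ 2 * p ^ 2 / (2 * p - 1) < ψ * L := by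
    have t : Tendsto (fun p : ℝ => 1 / 4 + ω ^ 2 * p ^ 2 / (2 * p - 1)) (𝓝[>] 1)
        (𝓝 (1 / 4 + ω ^ 2 * 1 ^ 2 / (2 * 1 - 1))) := by
      refine Tendsto.mono_left ?_ nhdsWithin_le_nhds
      refine tendsto_const_nhds.add (Tendsto.div (Continuous.tendsto (by fun_prop) _)
        (Continuous.tendsto (by fun_prop) _) (by norm_num))
    have := (t.eventually (eventually_lt_nhds (b := ψ * L) (by norm_num; linarith))).and
      self_mem_nhdsWithin
    obtain ⟨p, h1, h2⟩ := this.exists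
    exact ⟨p, h2, h1⟩
  obtain ⟨R, hR1, ε, hε, htr⟩ := H.trial_one hω0 hp hpc
  have hR0 : 0 < R := by linarith
  set δ : ℝ := (T - π / ω) / 3 with hδ
  have hδ0 : 0 < δ := by rw [hδ]; linarith
  refine ⟨|(log ε / 2 - log R) / T| + 1, fun E hE1 hE => ?_⟩
  have hEpos : 0 < |E| := abs_pos.2 hE.ne
  have hEabs : |E| = -E := abs_of_neg hE
  have hlogE : log (|E|) ≤ 0 := Real.log_nonpos (abs_nonneg _) (by rw [hEabs]; linarith)
  set y : ℝ := (log ε / 2 - log R - log (|E|) / 2) / T with hy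
  refine ⟨⌊y⌋₊, ?_, ?_⟩
  · have h1 : y - 1 < ⌊y⌋₊ := Nat.sub_one_lt_floor y
    have h2 : y = (log ε / 2 - log R) / T + |log (|E|)| / (2 * T) := by
      rw [hy, abs_of_nonpos hlogE]; field_simp; ring
    have h3 := neg_abs_le ((log ε / 2 - log R) / T)
    linarith
  by_cases hn : ⌊y⌋₊ = 0
  · rw [hn]; exact Trial.zero V E
  have hfl : (⌊y⌋₊ : ℝ) ≤ y := Nat.floor_le (by
    by_contra h
    exact hn (Nat.floor_of_nonpos (by linarith)))
  have hexp : ∀ k : Fin ⌊y⌋₊, |E| * (R * exp (k * T + δ) * exp (π / ω)) ^ 2 ≤ ε := by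
    intro k
    have hk : ((k : ℕ) : ℝ) + 1 ≤ ⌊y⌋₊ := by exact_mod_cast k.2
    rw [← Real.log_le_log_iff (by positivity) hε, Real.log_mul hEpos.ne' (by positivity),
      Real.log_pow, Real.log_mul (by positivity) (by positivity),
      Real.log_mul (by positivity) (by positivity), Real.log_exp, Real.log_exp]
    have h1 : (((k : ℕ) : ℝ) + 1) * T ≤ y * T := by gcongr; linarith
    have h2 : y * T = log ε / 2 - log R - log (|E|) / 2 := by
      rw [hy]; field_simp
    have h3 : δ + π / ω ≤ T := by rw [hδ]; linarith
    push_cast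
    linarith
  have hU := fun k : Fin ⌊y⌋₊ => htr E hE (R * exp (k * T + δ))
    (le_mul_of_one_le_right hR0.le (Real.one_le_exp (by positivity))) (hexp k)
    (R * exp (k * T)) (R * exp (k * T + T - δ)) (by gcongr; linarith) (by
      rw [mul_assoc, ← Real.exp_add]
      gcongr
      rw [hδ]; linarith)
  choose U hU1 hU2 hU3 hU4 using hU
  refine ⟨U, hU1, hU2, ?_, hU4, ?_⟩
  · have hlt : ∀ i j : Fin ⌊y⌋₊, i < j → Disjoint (tsupport (U i)) (tsupport (U j)) := by
      intro i j hij
      refine Disjoint.mono (hU3 i) (hU3 j) ?_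
      rw [Set.disjoint_left]
      intro x hx hx'
      have hij' : ((i : ℕ) : ℝ) + 1 ≤ ((j : ℕ) : ℝ) := by exact_mod_cast hij
      have : R * exp (i * T + T - δ) < R * exp (j * T) := by
        gcongr
        nlinarith
      linarith [hx.2, hx'.1]
    intro i j hij
    rcases lt_or_gt_of_ne hij with h | h
    · exact hlt i j h
    · exact (hlt j i h).symm
  · intro i x hx
    have := (hU3 i hx).1
    exact lt_of_lt_of_le (by positivity) this

/-! ### Conclusion -/

lemma HL.upper_eps (H : HL V φ f f1 X W W1 W2 ψ C L) {ε : ℝ} (hε : 0 < ε) :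
    ∃ R, 1 ≤ R ∧ ∃ K : ℝ, ∀ E, -1 < E → E < 0 → ∃ S : Finset ℝ,
      (S.card : ℝ) ≤ (√(max (ψ * L - 1 / 4) 0) / (2 * π) + ε) * |Real.log (|E|)| + K ∧
      ∃ B, ∀ b ≥ B, NN V E R b (insert b S) := by
  set ν := √(max (ψ * L - 1 / 4) 0) with hν
  have hν0 : 0 ≤ ν := Real.sqrt_nonneg _
  have hπ := Real.pi_pos
  have ha : 0 < ν / (2 * π) + ε := by positivity
  obtain ⟨R, hR, K, hK⟩ := H.upper (T := 1 / (2 * (ν / (2 * π) + ε))) (by positivity) (by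
    rw [← hν, div_mul_eq_mul_div, one_mul, div_lt_iff₀ (by positivity)]
    have : π * (2 * (ν / (2 * π) + ε)) = ν + 2 * π * ε := by field_simp
    rw [this]
    have : 0 < 2 * π * ε := by positivity
    linarith)
  refine ⟨R, hR, K, fun E h1 h2 => ?_⟩
  obtain ⟨S, hS, hB⟩ := hK E h1 h2
  refine ⟨S, hS.trans (le_of_eq ?_), hB⟩
  congr 1
  field_simp

lemma HL.lower_eps (H : HL V φ f f1 X W W1 W2 ψ C L) {ε : ℝ} (hε : 0 < ε) :
    ∃ K : ℝ, ∀ E, -1 < E → E < 0 → ∃ n : ℕ,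
      (√(max (ψ * L - 1 / 4) 0) / (2 * π) - ε) * |Real.log (|E|)| - K ≤ n ∧ Trial V E n := by
  set ν := √(max (ψ * L - 1 / 4) 0) with hν
  have hν0 : 0 ≤ ν := Real.sqrt_nonneg _
  have hπ := Real.pi_pos
  by_cases ha : ν / (2 * π) - ε ≤ 0
  · refine ⟨0, fun E _ _ => ⟨0, ?_, Trial.zero V E⟩⟩
    have := mul_nonneg (neg_nonneg.2 ha) (abs_nonneg (Real.log (|E|)))
    push_cast
    linarith
  · push Not at ha
    obtain ⟨K, hK⟩ := H.lower (T := 1 / (2 * (ν / (2 * π) - ε))) (by positivity) (by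
      rw [← hν, div_mul_eq_mul_div, one_mul, lt_div_iff₀ (by positivity)]
      have : π * (2 * (ν / (2 * π) - ε)) = ν - 2 * π * ε := by field_simp
      rw [this]
      have : 0 < 2 * π * ε := by positivity
      linarith)
    refine ⟨K, fun E h1 h2 => ?_⟩
    obtain ⟨n, hn, hT⟩ := hK E h1 h2
    refine ⟨n, le_trans (le_of_eq ?_) hn, hT⟩
    congr 1
    field_simp

/-- The half-line data on both sides. -/
lemma exists_HL (η φ : ℝ → ℝ) (hη : IsAdmissible1 η 0 φ) (ψ₀ : ℝ) (χ : ℝ → ℝ)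
    (hψ : IsAdmissible1 (fun x => deriv φ x ^ 2) ψ₀ χ)
    (W : ℝ → ℝ) (hW : SClass1 3 1 W) (L1 Lm : ℝ)
    (hL1 : Tendsto (fun r : ℝ => r ^ 2 * W r ^ 2) atTop (𝓝 L1))
    (hLm : Tendsto (fun r : ℝ => r ^ 2 * W (-r) ^ 2) atTop (𝓝 Lm)) :
    ∃ (f f1 X W1 W2 φ' f' f1' X' W' W1' W2' : ℝ → ℝ) (C : ℝ),
      HL (fun x => η x * W x) φ f f1 X W W1 W2 ψ₀ C L1 ∧
      HL (fun x => (fun x => η x * W x) (-x)) φ' f' f1' X' W' W1' W2' ψ₀ C Lm := by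
  obtain ⟨M1, hM1⟩ := hη.bounded
  obtain ⟨M2, hM2⟩ := hψ.bounded
  obtain ⟨hWs, CW, hCW, hWb⟩ := hW
  have d2 : ∀ {g : ℝ → ℝ}, ContDiff ℝ 2 g → ContDiff ℝ 1 (deriv g) := by
    intro g hg
    exact (contDiff_succ_iff_deriv (n := 1) (f := g)).1 (by rw [one_add_one_eq_two]; exact hg) |>.2.2
  have dφ : ∀ x, HasDerivAt φ (deriv φ x) x := fun x =>
    (hη.smooth.differentiable (by norm_num) x).hasDerivAt
  have hφ1 := d2 hη.smooth
  have df : ∀ x, HasDerivAt (deriv φ) (deriv (deriv φ) x) x := fun x =>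
    (hφ1.differentiable (by norm_num) x).hasDerivAt
  have hχ1 := d2 hψ.smooth
  have dX : ∀ x, HasDerivAt (deriv χ) (deriv φ x ^ 2 - ψ₀) x := fun x => by
    rw [← hψ.poisson x]
    exact (hχ1.differentiable (by norm_num) x).hasDerivAt
  have hW2 : ContDiff ℝ 2 W := hWs.of_le (by norm_num)
  have dW : ∀ x, HasDerivAt W (deriv W x) x := fun x =>
    (hW2.differentiable (by norm_num) x).hasDerivAt
  have dW1 : ∀ x, HasDerivAt (deriv W) (deriv (deriv W) x) x := fun x =>
    ((d2 hW2).differentiable (by norm_num) x).hasDerivAt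
  have hηe : ∀ x, η x = deriv (deriv φ) x := fun x => by rw [hη.poisson x, sub_zero]
  have hVc : Continuous (fun x => η x * W x) := by
    have : (fun x => η x * W x) = fun x => deriv (deriv φ) x * W x := by
      funext x; rw [hηe]
    rw [this]
    exact (hφ1.continuous_deriv (by norm_num)).mul hW2.continuous
  have key : ∀ k : ℕ, k ≤ 3 → ∀ x : ℝ, ∀ y : ℝ, |y| = x → 1 ≤ x →
      |iteratedDeriv k W y| * x ^ (k + 1) ≤ CW := by
    intro k hk x y hy hx
    have hx0 : 0 < x := by linarith
    have h := hWb k hk y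
    rw [hy] at h
    have e : (1 + x) ^ (-1 - (k : ℝ)) = ((1 + x) ^ (k + 1))⁻¹ := by
      rw [← Real.rpow_natCast, ← Real.rpow_neg (by positivity)]
      congr 1
      push_cast
      ring
    rw [e, ← div_eq_mul_inv, le_div_iff₀ (by positivity)] at h
    refine le_trans ?_ h
    gcongr
    linarith
  have b0 : ∀ y : ℝ, 1 ≤ |y| → |W y| * |y| ≤ CW := fun y hy => by
    simpa using key 0 (by norm_num) |y| y rfl hy
  have b1 : ∀ y : ℝ, 1 ≤ |y| → |deriv W y| * |y| ^ 2 ≤ CW := fun y hy => by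
    simpa [iteratedDeriv_one] using key 1 (by norm_num) |y| y rfl hy
  have b2 : ∀ y : ℝ, 1 ≤ |y| → |deriv (deriv W) y| * |y| ^ 3 ≤ CW := fun y hy => by
    have := key 2 (by norm_num) |y| y rfl hy
    rwa [iteratedDeriv_succ, iteratedDeriv_one] at this
  have hM1' : 0 ≤ M1 := (abs_nonneg _).trans (hM1 0).1
  have hM2' : 0 ≤ M2 := (abs_nonneg _).trans (hM2 0).1
  have neg : ∀ {g g' : ℝ → ℝ}, (∀ x, HasDerivAt g (g' x) x) →
      ∀ x, HasDerivAt (fun x => g (-x)) (-g' (-x)) x := by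
    intro g g' h x
    have h1 : HasDerivAt (fun x => g (-x)) (g' (-x) * -1) x := (h (-x)).comp x (hasDerivAt_neg x)
    exact h1.congr_deriv (by ring)
  refine ⟨deriv φ, deriv (deriv φ), deriv χ, deriv W, deriv (deriv W),
    fun x => φ (-x), fun x => -deriv φ (-x), fun x => deriv (deriv φ) (-x),
    fun x => -deriv χ (-x), fun x => W (-x), fun x => -deriv W (-x),
    fun x => deriv (deriv W) (-x), M1 + M2 + CW, ?_, ?_⟩
  · refine ⟨hVc, fun x => by simp only [hηe], dφ, df, dX, dW, dW1, by linarith,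
      fun x => by linarith [(hM1 x).1], fun x => by linarith [(hM1 x).2.1],
      fun x => by linarith [(hM2 x).2.1], fun x hx => ?_, fun x hx => ?_, fun x hx => ?_, hL1⟩
    · rw [abs_mul]
      linarith [b0 x (hx.trans (le_abs_self x))]
    · rw [abs_mul, abs_pow]
      linarith [b1 x (hx.trans (le_abs_self x))]
    · rw [abs_mul, abs_pow]
      linarith [b2 x (hx.trans (le_abs_self x))]
  · refine ⟨hVc.comp continuous_neg, fun x => by simp only [hηe], neg dφ,
      fun x => ?_, fun x => ?_, neg dW, fun x => ?_, by linarith,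
      fun x => by linarith [(hM1 (-x)).1],
      fun x => by rw [abs_neg]; linarith [(hM1 (-x)).2.1],
      fun x => by rw [abs_neg]; linarith [(hM2 (-x)).2.1],
      fun x hx => ?_, fun x hx => ?_, fun x hx => ?_, hLm⟩
    · exact HasDerivAt.congr_deriv (neg df x).neg (neg_neg _)
    · exact HasDerivAt.congr_deriv (neg dX x).neg (by ring)
    · exact HasDerivAt.congr_deriv (neg dW1 x).neg (neg_neg _)
    · have h := b0 (-x) (by rw [abs_neg]; exact hx.trans (le_abs_self x))
      rw [abs_neg] at h
      rw [abs_mul]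
      linarith
    · have h := b1 (-x) (by rw [abs_neg]; exact hx.trans (le_abs_self x))
      rw [abs_neg] at h
      rw [abs_mul, abs_neg, abs_pow]
      linarith
    · have h := b2 (-x) (by rw [abs_neg]; exact hx.trans (le_abs_self x))
      rw [abs_neg] at h
      rw [abs_mul, abs_pow]
      linarith

lemma finite_part {φ' f' f1' X' W' W1' W2' : ℝ → ℝ} {C' L' : ℝ}
    (H : HL V φ f f1 X W W1 W2 ψ C L)
    (H' : HL (fun x => V (-x)) φ' f' f1' X' W' W1' W2' ψ C' L')
    (hL : ψ * L < 1 / 4) (hL' : ψ * L' < 1 / 4) :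
    (⨆ E ∈ Set.Iio (0 : ℝ), schN1 V E) < ⊤ := by
  obtain ⟨R1, hR1, h1⟩ := H.sub hL
  obtain ⟨R2, hR2, h2⟩ := H'.sub hL'
  obtain ⟨S3, h3⟩ := NN.middle H.Vc (show -R2 < R1 by linarith)
  refine lt_of_le_of_lt (iSup₂_le (a := (((({R1} : Finset ℝ).card + ({R2} : Finset ℝ).card
    + S3.card : ℕ)) : ℕ∞)) fun E hE => ?_) (ENat.coe_lt_top _)
  have hE0 : E ≤ 0 := le_of_lt hE
  refine schN1_le_of_pieces H.Vc {R1} {R2} S3 ⟨R1, fun b hb => ?_⟩ ⟨R2, fun b hb => ?_⟩ (h3 E hE0)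
  · exact (h1 E hE0 b hb).mono (by rw [Finset.pair_comm])
  · exact (h2 E hE0 b hb).mono (by rw [Finset.pair_comm])

lemma upper_part {φ' f' f1' X' W' W1' W2' : ℝ → ℝ} {C' L' : ℝ}
    (H : HL V φ f f1 X W W1 W2 ψ C L)
    (H' : HL (fun x => V (-x)) φ' f' f1' X' W' W1' W2' ψ C' L') {ε : ℝ} (hε : 0 < ε) :
    ∃ K : ℝ, ∀ E, -1 < E → E < 0 → schN1 V E ≠ ⊤ ∧ ((schN1 V E).toNat : ℝ) ≤
      (1 / (2 * π) * (√(max (ψ * L - 1 / 4) 0) + √(max (ψ * L' - 1 / 4) 0)) + 2 * ε)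
        * |Real.log (|E|)| + K := by
  obtain ⟨R1, hR1, K1, h1⟩ := H.upper_eps hε
  obtain ⟨R2, hR2, K2, h2⟩ := H'.upper_eps hε
  obtain ⟨S3, h3⟩ := NN.middle H.Vc (show -R2 < R1 by linarith)
  refine ⟨K1 + K2 + S3.card, fun E hE1 hE2 => ?_⟩
  obtain ⟨S1, c1, B1⟩ := h1 E hE1 hE2
  obtain ⟨S2, c2, B2⟩ := h2 E hE1 hE2
  have h := schN1_le_of_pieces H.Vc S1 S2 S3 B1 B2 (h3 E hE2.le)
  have hne : schN1 V E ≠ ⊤ := (lt_of_le_of_lt h (ENat.coe_lt_top _)).ne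
  refine ⟨hne, ?_⟩
  have h' : (schN1 V E).toNat ≤ S1.card + S2.card + S3.card := ENat.toNat_le_of_le_coe h
  have h'' : ((schN1 V E).toNat : ℝ) ≤ S1.card + S2.card + S3.card := by exact_mod_cast h'
  refine h''.trans ?_
  have : (1 / (2 * π) * (√(max (ψ * L - 1 / 4) 0) + √(max (ψ * L' - 1 / 4) 0)) + 2 * ε)
        * |Real.log (|E|)| + (K1 + K2 + S3.card) =
      ((√(max (ψ * L - 1 / 4) 0) / (2 * π) + ε) * |Real.log (|E|)| + K1) +
      ((√(max (ψ * L' - 1 / 4) 0) / (2 * π) + ε) * |Real.log (|E|)| + K2) + S3.card := by ring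
  linarith

lemma lower_part {φ' f' f1' X' W' W1' W2' : ℝ → ℝ} {C' L' : ℝ}
    (H : HL V φ f f1 X W W1 W2 ψ C L)
    (H' : HL (fun x => V (-x)) φ' f' f1' X' W' W1' W2' ψ C' L') {ε : ℝ} (hε : 0 < ε) :
    ∃ K : ℝ, ∀ E, -1 < E → E < 0 → schN1 V E ≠ ⊤ →
      (1 / (2 * π) * (√(max (ψ * L - 1 / 4) 0) + √(max (ψ * L' - 1 / 4) 0)) - 2 * ε)
        * |Real.log (|E|)| - K ≤ ((schN1 V E).toNat : ℝ) := by
  obtain ⟨K1, h1⟩ := H.lower_eps hε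
  obtain ⟨K2, h2⟩ := H'.lower_eps hε
  refine ⟨K1 + K2, fun E hE1 hE2 hne => ?_⟩
  obtain ⟨n, c1, T1⟩ := h1 E hE1 hE2
  obtain ⟨m, c2, T2⟩ := h2 E hE1 hE2
  have h := T1.combine H.Vc T2
  have h' : n + m ≤ (schN1 V E).toNat := by
    rw [← ENat.coe_toNat hne] at h
    exact_mod_cast h
  have h'' : (n : ℝ) + m ≤ ((schN1 V E).toNat : ℝ) := by exact_mod_cast h'
  refine le_trans ?_ h''
  have : (1 / (2 * π) * (√(max (ψ * L - 1 / 4) 0) + √(max (ψ * L' - 1 / 4) 0)) - 2 * ε)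
        * |Real.log (|E|)| - (K1 + K2) =
      ((√(max (ψ * L - 1 / 4) 0) / (2 * π) - ε) * |Real.log (|E|)| - K1) +
      ((√(max (ψ * L' - 1 / 4) 0) / (2 * π) - ε) * |Real.log (|E|)| - K2) := by ring
  linarith

lemma tendsto_log_zero : Tendsto (fun E : ℝ => |Real.log (|E|)|) (𝓝[<] 0) atTop := by
  have h : Tendsto (fun E : ℝ => Real.log E) (𝓝[<] 0) atBot :=
    Real.tendsto_log_nhdsNE_zero.mono_left (nhdsWithin_mono _ (fun x hx => ne_of_lt hx))
  have := tendsto_abs_atBot_atTop.comp h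
  refine this.congr fun E => ?_
  simp [Real.log_abs]

lemma limit_part {φ' f' f1' X' W' W1' W2' : ℝ → ℝ} {C' L' : ℝ}
    (H : HL V φ f f1 X W W1 W2 ψ C L)
    (H' : HL (fun x => V (-x)) φ' f' f1' X' W' W1' W2' ψ C' L') :
    (∀ᶠ E in 𝓝[<] (0 : ℝ), schN1 V E ≠ ⊤) ∧
      Tendsto (fun E : ℝ => ((schN1 V E).toNat : ℝ) / |Real.log (|E|)|) (𝓝[<] 0)
        (𝓝 (1 / (2 * π) * (√(max (ψ * L - 1 / 4) 0) + √(max (ψ * L' - 1 / 4) 0)))) := by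
  have hev : ∀ᶠ E in 𝓝[<] (0 : ℝ), -1 < E ∧ E < 0 := by
    filter_upwards [Ioo_mem_nhdsLT (show (-1 : ℝ) < 0 by norm_num)] with E hE using hE
  constructor
  · obtain ⟨K, hK⟩ := upper_part H H' one_pos
    filter_upwards [hev] with E hE using (hK E hE.1 hE.2).1
  set Λ := 1 / (2 * π) * (√(max (ψ * L - 1 / 4) 0) + √(max (ψ * L' - 1 / 4) 0)) with hΛ
  rw [Metric.tendsto_nhds]
  intro ε hε
  obtain ⟨K, hK⟩ := upper_part H H' (show 0 < ε / 8 by positivity)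
  obtain ⟨K', hK'⟩ := lower_part H H' (show 0 < ε / 8 by positivity)
  rw [← hΛ] at hK hK'
  filter_upwards [hev, tendsto_log_zero.eventually_gt_atTop 0,
    tendsto_log_zero.eventually_gt_atTop (2 * |K| / ε),
    tendsto_log_zero.eventually_gt_atTop (2 * |K'| / ε)] with E hE h0 h1 h2
  obtain ⟨hne, hu⟩ := hK E hE.1 hE.2
  have hl := hK' E hE.1 hE.2 hne
  set l := |Real.log (|E|)|
  rw [div_lt_iff₀ hε] at h1 h2
  rw [Real.dist_eq, abs_lt, lt_sub_iff_add_lt, sub_lt_iff_lt_add, lt_div_iff₀ h0, div_lt_iff₀ h0]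
  have hεl : 0 < ε * l := by positivity
  constructor
  · nlinarith [le_abs_self K']
  · nlinarith [le_abs_self K]

end Aux

/-- Theorem 3.2 (ii) for `d = 1`: logarithmic eigenvalue asymptotics in the case `η₀ = 0`,
`ρ = 1`, governed by the effective Hamiltonian `-d²/dx² - ψ₀ W²`, and finiteness of the
discrete spectrum when `λ₁(-ψ₀ 𝓛) > -1/4`. -/
theorem eigenvalue_asymptotics_zero_mean_border_case_dim_one
    (η φ : ℝ → ℝ) (hη : IsAdmissible1 η 0 φ)
    (ψ₀ : ℝ) (hψ₀ : 0 < ψ₀) (χ : ℝ → ℝ)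
    (hψ : IsAdmissible1 (fun x => deriv φ x ^ 2) ψ₀ χ)
    (χ' : ℝ → ℝ) (hφ' : IsAdmissible1 (fun x => deriv φ x) 0 χ')
    (W : ℝ → ℝ) (hW : SClass1 3 1 W)
    (L1 Lm : ℝ)
    (hL1 : Tendsto (fun r : ℝ => r ^ 2 * W r ^ 2) atTop (𝓝 L1))
    (hLm : Tendsto (fun r : ℝ => r ^ 2 * W (-r) ^ 2) atTop (𝓝 Lm)) :
    ((∀ᶠ E in 𝓝[<] (0 : ℝ), schN1 (fun x => η x * W x) E ≠ ⊤) ∧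
      Tendsto (fun E : ℝ =>
          ((schN1 (fun x => η x * W x) E).toNat : ℝ) / |Real.log (|E|)|)
        (𝓝[<] 0)
        (𝓝 ((1 / (2 * π)) *
          (Real.sqrt (max (-(-ψ₀ * L1 + 1 / 4)) 0) +
            Real.sqrt (max (-(-ψ₀ * Lm + 1 / 4)) 0))))) ∧
    (-(1 / 4 : ℝ) < min (-ψ₀ * L1) (-ψ₀ * Lm) →
      (⨆ E ∈ Set.Iio (0 : ℝ), schN1 (fun x => η x * W x) E) < ⊤) := by
  obtain ⟨f, f1, X, W1, W2, φ', f', f1', X', W', W1', W2', C, H, H'⟩ :=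
    exists_HL η φ hη ψ₀ χ hψ W hW L1 Lm hL1 hLm
  refine ⟨?_, fun hmin => ?_⟩
  · have e : ∀ L : ℝ, -(-ψ₀ * L + 1 / 4) = ψ₀ * L - 1 / 4 := fun L => by ring
    rw [e, e]
    exact limit_part H H'
  · have h := lt_min_iff.1 hmin
    exact finite_part H H' (by linarith [h.1]) (by linarith [h.2])

end
end
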